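/- arXiv:1409.6323 — 3 statements merged into one kernel-verified Lean document; each statement's English description precedes it below -/
import Mathlib

section
/- Let n ≥ 5 be odd, let V : ℝⁿ → ℝ be measurable with |V(x)| ≤ C₀⟨x⟩^{−(n+1)/2−ε} for some ε > 0, let σ > 1/2, and let κ be an integer with κ ≥ (n+3)/4. For λ ≥ 0, x, y ∈ ℝⁿ define the iterated kernel K_λ(y, x) = ∫_{ℝ^{(κ−1)n}} g_n(λ, |y − z₁|) · V(z₁) · g_n(λ, |z₁ − z₂|) · V(z₂) ⋯ V(z_{κ−1}) · g_n(λ, |z_{κ−1} − x|) dz₁ ⋯ dz_{κ−1} (with κ factors of g_n and κ−1 factors of V). Then the defining integral converges absolutely for a.e. y, and there is a constant C such that for every x ∈ ℝⁿ and every λ ≥ 0: ( ∫_{ℝⁿ} ⟨y⟩^{−2σ} |K_λ(y, x)|² dy )^{1/2} ≤ C ⟨λ⟩^{κ(n−3)/2}, where ⟨λ⟩ = 1 + λ. -/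
open MeasureTheory Complex Real Finset

/-- The Green's function constant `c₀(n) = Γ(n/2 − 1)/(4 π^{n/2})`. -/
noncomputable def green0 (n : ℕ) : ℝ :=
  Real.Gamma ((n : ℝ) / 2 - 1) / (4 * Real.pi ^ ((n : ℝ) / 2))

/-- The constant `C_n = c₀(n) · ((n−3)/2)!/(n−3)!`. -/
noncomputable def resC (n : ℕ) : ℝ :=
  green0 n * (Nat.factorial ((n - 3) / 2)) / (Nat.factorial (n - 3))

/-- The kernel `g_n(λ, r)` of the limiting free resolvent `(−Δ − λ² − i0)^{−1}` on `ℝ^n`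
for odd `n ≥ 3`. -/
noncomputable def gker (n : ℕ) (lam r : ℝ) : ℂ :=
  (resC n : ℂ) * Complex.exp (Complex.I * (lam : ℂ) * (r : ℂ)) / (r : ℂ) ^ (n - 2) *
    ∑ l ∈ Finset.range ((n - 3) / 2 + 1),
      ((Nat.factorial (n - 3 - l) : ℂ) /
          ((Nat.factorial l : ℂ) * (Nat.factorial ((n - 3) / 2 - l) : ℂ))) *
        ((-2) * Complex.I * (r : ℂ) * (lam : ℂ)) ^ l


/-- The chain of points `y = p₀, z₁, …, z_{κ−1}, p_κ = x` used in the iterated resolvent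
kernel: `p 0 = y`, `p j = z_j` for `1 ≤ j ≤ κ−1`, and `p j = x` otherwise. -/
noncomputable def chainPt {n m : ℕ} (y x : EuclideanSpace ℝ (Fin n))
    (z : Fin m → EuclideanSpace ℝ (Fin n)) (j : ℕ) : EuclideanSpace ℝ (Fin n) :=
  if j = 0 then y else if h : j - 1 < m then z ⟨j - 1, h⟩ else x

/-- The integrand of the iterated kernel `(R₀V)^{κ−1}R₀`:
`g_n(λ,|y−z₁|) V(z₁) g_n(λ,|z₁−z₂|) ⋯ V(z_{κ−1}) g_n(λ,|z_{κ−1}−x|)`. -/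
noncomputable def iterIntegrand (n κ : ℕ) (V : EuclideanSpace ℝ (Fin n) → ℝ) (lam : ℝ)
    (y x : EuclideanSpace ℝ (Fin n)) (z : Fin (κ - 1) → EuclideanSpace ℝ (Fin n)) : ℂ :=
  (∏ j ∈ Finset.range κ, gker n lam ‖chainPt y x z j - chainPt y x z (j + 1)‖) *
    ∏ j : Fin (κ - 1), (V (z j) : ℂ)

/-- The iterated kernel `K_λ(y,x)`, obtained by integrating out the intermediate
variables `z₁, …, z_{κ−1}`. -/
noncomputable def iterKernel (n κ : ℕ) (V : EuclideanSpace ℝ (Fin n) → ℝ) (lam : ℝ)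
    (y x : EuclideanSpace ℝ (Fin n)) : ℂ :=
  ∫ z : Fin (κ - 1) → EuclideanSpace ℝ (Fin n), iterIntegrand n κ V lam y x z

section Kernels

open Module

variable {E : Type*} [NormedAddCommGroup E]

/-- The Riesz-type kernel `‖v‖^{-s}` with values in `[0, ∞]`. -/
noncomputable def rieszKer (s : ℝ) (v : E) : ENNReal := ‖v‖ₑ⁻¹ ^ s

/-- The Japanese-bracket weight `(1 + ‖v‖)^{-m}` with values in `[0, ∞]`. -/
noncomputable def bracketWeight (m : ℝ) (v : E) : ENNReal := (1 + ‖v‖ₑ)⁻¹ ^ m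

/-- A kernel with local singularity `‖v‖^{-α}` and decay `‖v‖^{-β}`. -/
noncomputable def twoScaleKer (α β : ℝ) (v : E) : ENNReal := rieszKer α v + rieszKer β v

theorem rpow_mul_rpow_le_add {a b : ENNReal} {p q : ℝ} (hp : 0 ≤ p) (hq : 0 ≤ q) :
    a ^ p * b ^ q ≤ a ^ (p + q) + b ^ (p + q) := by
  rcases le_total a b with h | h
  · calc a ^ p * b ^ q ≤ b ^ p * b ^ q := by gcongr
      _ = b ^ (p + q) := (ENNReal.rpow_add_of_nonneg _ _ hp hq).symm
      _ ≤ _ := le_add_self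
  · calc a ^ p * b ^ q ≤ a ^ p * a ^ q := by gcongr
      _ = a ^ (p + q) := (ENNReal.rpow_add_of_nonneg _ _ hp hq).symm
      _ ≤ _ := le_self_add

theorem rpow_mul_rpow_le_of_le_two_mul {u v d : ENNReal} {a b c : ℝ} (hc : 0 ≤ c) (hca : c ≤ a)
    (hb : 0 ≤ b) (h : u ≤ 2 * d) :
    u ^ a * v ^ b ≤ 2 ^ c * d ^ c * (u ^ (a + b - c) + v ^ (a + b - c)) := by
  calc u ^ a * v ^ b = u ^ c * (u ^ (a - c) * v ^ b) := by
        rw [← mul_assoc, ← ENNReal.rpow_add_of_nonneg _ _ hc (by linarith), add_sub_cancel]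
    _ ≤ (2 * d) ^ c * (u ^ (a - c + b) + v ^ (a - c + b)) := by
        gcongr
        exact rpow_mul_rpow_le_add (by linarith) hb
    _ = _ := by
        rw [ENNReal.mul_rpow_of_nonneg _ _ hc, show a - c + b = a + b - c by ring]

theorem inv_le_two_mul_inv_of_le_two_mul {D U : ENNReal} (h : D ≤ 2 * U) : U⁻¹ ≤ 2 * D⁻¹ := by
  have h2 : (2 * U)⁻¹ ≤ D⁻¹ := ENNReal.inv_le_inv.2 h
  rw [ENNReal.mul_inv (by simp) (by simp)] at h2
  calc U⁻¹ = 2 * (2⁻¹ * U⁻¹) := by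
        rw [← mul_assoc, ENNReal.mul_inv_cancel (by simp) (by simp), one_mul]
    _ ≤ 2 * D⁻¹ := by gcongr

theorem rieszKer_sub_rev (s : ℝ) (x y : E) : rieszKer s (x - y) = rieszKer s (y - x) := by
  rw [rieszKer, rieszKer, enorm_sub_rev]

theorem rieszKer_mul_rieszKer_le (x y z : E) {a b c : ℝ} (hc : 0 ≤ c) (hca : c ≤ a)
    (hcb : c ≤ b) :
    rieszKer a (y - z) * rieszKer b (z - x) ≤ 2 ^ c * rieszKer c (y - x) *
      (rieszKer (a + b - c) (y - z) + rieszKer (a + b - c) (z - x)) := by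
  have hD : ‖y - x‖ₑ ≤ ‖y - z‖ₑ + ‖z - x‖ₑ := by
    rw [← sub_add_sub_cancel y z x]
    exact enorm_add_le _ _
  unfold rieszKer
  rcases le_total ‖z - x‖ₑ ‖y - z‖ₑ with h | h
  · refine rpow_mul_rpow_le_of_le_two_mul hc hca (hc.trans hcb)
      (inv_le_two_mul_inv_of_le_two_mul ?_)
    rw [two_mul]
    exact hD.trans (by gcongr)
  · rw [mul_comm, add_comm (_ ^ _) (_ ^ _), add_comm a b]
    refine rpow_mul_rpow_le_of_le_two_mul hc hcb (hc.trans hca)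
      (inv_le_two_mul_inv_of_le_two_mul ?_)
    rw [two_mul]
    exact hD.trans (by gcongr)

theorem bracketWeight_le_one {m : ℝ} (hm : 0 ≤ m) (v : E) : bracketWeight m v ≤ 1 :=
  ENNReal.rpow_le_one (ENNReal.inv_le_one.2 le_self_add) hm

theorem rieszKer_mul_bracketWeight_le {s m : ℝ} (hs : 0 ≤ s) (hm : 0 ≤ m) (x z : E) :
    rieszKer s (z - x) * bracketWeight m z ≤
      (Metric.ball (0 : E) 1).indicator (rieszKer s) (z - x) +
        2 ^ s * (bracketWeight (s + m) (z - x) + bracketWeight (s + m) z) := by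
  by_cases h : z - x ∈ Metric.ball (0 : E) 1
  · rw [Set.indicator_of_mem h]
    refine le_trans ?_ le_self_add
    exact mul_le_of_le_one_right' (bracketWeight_le_one hm z)
  · rw [Set.indicator_of_notMem h, zero_add]
    have h1 : 1 ≤ ‖z - x‖ₑ := by
      rw [mem_ball_zero_iff, not_lt] at h
      rw [← ofReal_norm]
      simpa using ENNReal.ofReal_le_ofReal h
    have h2 : ‖z - x‖ₑ⁻¹ ≤ 2 * (1 + ‖z - x‖ₑ)⁻¹ := by
      apply inv_le_two_mul_inv_of_le_two_mul
      rw [two_mul]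
      gcongr
    calc rieszKer s (z - x) * bracketWeight m z
        ≤ (2 * (1 + ‖z - x‖ₑ)⁻¹) ^ s * bracketWeight m z := by
          unfold rieszKer; gcongr
      _ = 2 ^ s * ((1 + ‖z - x‖ₑ)⁻¹ ^ s * (1 + ‖z‖ₑ)⁻¹ ^ m) := by
          rw [ENNReal.mul_rpow_of_nonneg _ _ hs, mul_assoc]; rfl
      _ ≤ _ := by
          gcongr
          exact rpow_mul_rpow_le_add hs hm

theorem bracketWeight_eq_ofReal (m : ℝ) (v : E) :
    bracketWeight m v = ENNReal.ofReal ((1 + ‖v‖) ^ (-m)) := by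
  have h : 0 < 1 + ‖v‖ := by positivity
  rw [bracketWeight, ENNReal.inv_rpow, ← ENNReal.rpow_neg, ← ENNReal.ofReal_rpow_of_pos h,
    ENNReal.ofReal_add zero_le_one (norm_nonneg _), ofReal_norm, ENNReal.ofReal_one]

variable [MeasurableSpace E] [BorelSpace E]

@[fun_prop]
theorem measurable_rieszKer (s : ℝ) : Measurable (rieszKer s : E → ENNReal) := by
  unfold rieszKer; fun_prop

@[fun_prop]
theorem measurable_bracketWeight (m : ℝ) : Measurable (bracketWeight m : E → ENNReal) := by
  unfold bracketWeight; fun_prop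

@[fun_prop]
theorem measurable_twoScaleKer (α β : ℝ) : Measurable (twoScaleKer α β : E → ENNReal) := by
  unfold twoScaleKer; fun_prop

variable [NormedSpace ℝ E] [FiniteDimensional ℝ E] (μ : Measure E) [μ.IsAddHaarMeasure]

theorem lintegral_bracketWeight_ne_top {r : ℝ} (hr : (finrank ℝ E : ℝ) < r) :
    ∫⁻ z : E, bracketWeight r z ∂μ ≠ ⊤ := by
  simp_rw [bracketWeight_eq_ofReal]
  exact (finite_integral_one_add_norm hr).ne

theorem setLIntegral_ball_rieszKer_ne_top (hd : 1 ≤ finrank ℝ E) {s : ℝ}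
    (hs : s < finrank ℝ E) : ∫⁻ z in Metric.ball (0 : E) 1, rieszKer s z ∂μ ≠ ⊤ := by
  have : Nontrivial E := Module.nontrivial_of_finrank_pos (R := ℝ) hd
  have h := integrableOn_ball_of_norm_le_rpow (μ := μ) hd (f := fun z : E => ‖z‖ ^ (-s))
    (C := 1) (α := s) (r := 1) hs
    (.of_forall fun z => by simp [abs_of_nonneg (Real.rpow_nonneg (norm_nonneg z) _)])
    (by fun_prop : Measurable fun z : E => ‖z‖ ^ (-s)).aestronglyMeasurable
  refine ne_of_eq_of_ne (lintegral_congr_ae ?_) h.2.ne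
  refine ae_restrict_of_ae ?_
  filter_upwards [Measure.ae_ne μ (0 : E)] with z hz
  have hz' : 0 < ‖z‖ := norm_pos_iff.2 hz
  rw [rieszKer, ENNReal.inv_rpow, ← ENNReal.rpow_neg, ← ofReal_norm,
    ENNReal.ofReal_rpow_of_pos hz', Real.enorm_of_nonneg (by positivity)]

/-- A Riesz kernel integrated against a bracket weight is bounded uniformly in the pole. -/
theorem exists_lintegral_rieszKer_mul_bracketWeight_le (hd : 1 ≤ finrank ℝ E) {s m : ℝ}
    (hs : 0 ≤ s) (hsd : s < finrank ℝ E) (hm : 0 ≤ m) (hsm : (finrank ℝ E : ℝ) < s + m) :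
    ∃ M : ENNReal, M ≠ ⊤ ∧ ∀ x : E, ∫⁻ z, rieszKer s (z - x) * bracketWeight m z ∂μ ≤ M := by
  refine ⟨(∫⁻ z in Metric.ball (0 : E) 1, rieszKer s z ∂μ) +
    2 ^ s * ((∫⁻ z : E, bracketWeight (s + m) z ∂μ) + ∫⁻ z : E, bracketWeight (s + m) z ∂μ),
    ?_, fun x => ?_⟩
  · have h1 := setLIntegral_ball_rieszKer_ne_top μ hd hsd
    have h2 := lintegral_bracketWeight_ne_top μ hsm
    have h3 : (2 : ENNReal) ^ s ≠ ⊤ := ENNReal.rpow_ne_top_of_nonneg hs (by simp)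
    finiteness
  · refine (lintegral_mono fun z => rieszKer_mul_bracketWeight_le hs hm x z).trans_eq ?_
    have hF : Measurable ((Metric.ball (0 : E) 1).indicator (rieszKer s : E → ENNReal)) :=
      (measurable_rieszKer s).indicator measurableSet_ball
    rw [lintegral_add_left (by fun_prop), lintegral_const_mul _ (by fun_prop),
      lintegral_add_left (by fun_prop),
      lintegral_sub_right_eq_self
        (fun v => (Metric.ball (0 : E) 1).indicator (rieszKer s) v) x,
      lintegral_sub_right_eq_self (fun v => bracketWeight (s + m) v) x,
      lintegral_indicator measurableSet_ball]

/-- Weighted convolution of two Riesz kernels. -/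
theorem exists_lintegral_rieszKer_mul_rieszKer_le (hd : 1 ≤ finrank ℝ E) {a b c m : ℝ}
    (hc : 0 ≤ c) (hca : c ≤ a) (hcb : c ≤ b) (hm : 0 ≤ m)
    (h₁ : a + b - c < finrank ℝ E) (h₂ : (finrank ℝ E : ℝ) < a + b - c + m) :
    ∃ C : ENNReal, C ≠ ⊤ ∧ ∀ x y : E,
      ∫⁻ z, rieszKer a (y - z) * bracketWeight m z * rieszKer b (z - x) ∂μ ≤
        C * rieszKer c (y - x) := by
  obtain ⟨M, hM, hMle⟩ := exists_lintegral_rieszKer_mul_bracketWeight_le μ hd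
    (s := a + b - c) (m := m) (by linarith) h₁ hm h₂
  have h3 : (2 : ENNReal) ^ c ≠ ⊤ := ENNReal.rpow_ne_top_of_nonneg hc (by simp)
  refine ⟨2 ^ c * (M + M), by finiteness, fun x y => ?_⟩
  calc ∫⁻ z, rieszKer a (y - z) * bracketWeight m z * rieszKer b (z - x) ∂μ
      ≤ ∫⁻ z, (2 ^ c * rieszKer c (y - x)) *
          (rieszKer (a + b - c) (z - y) * bracketWeight m z +
            rieszKer (a + b - c) (z - x) * bracketWeight m z) ∂μ := by
        refine lintegral_mono fun z => ?_
        rw [mul_right_comm, ← add_mul, ← mul_assoc]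
        refine mul_le_mul' ?_ le_rfl
        have h := rieszKer_mul_rieszKer_le x y z hc hca hcb
        rwa [rieszKer_sub_rev (a + b - c) y z] at h
    _ = (2 ^ c * rieszKer c (y - x)) *
          ((∫⁻ z, rieszKer (a + b - c) (z - y) * bracketWeight m z ∂μ) +
            ∫⁻ z, rieszKer (a + b - c) (z - x) * bracketWeight m z ∂μ) := by
        rw [lintegral_const_mul _ (by fun_prop), lintegral_add_left (by fun_prop)]
    _ ≤ (2 ^ c * rieszKer c (y - x)) * (M + M) := by
        gcongr
        exacts [hMle y, hMle x]
    _ = _ := by ring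

/-- Composition with a two-scale kernel of maximal singularity `d - 2` lowers the singularity
by any amount less than `2`. -/
theorem exists_lintegral_twoScaleKer_mul_le (hd : 1 ≤ finrank ℝ E) {α α' β m : ℝ}
    (hβ : 0 ≤ β) (hβα : β ≤ α') (hα' : α' ≤ α) (hα : α ≤ finrank ℝ E - 2) (hαα' : α - 2 < α')
    (hm : 2 < m) (hβm : (finrank ℝ E : ℝ) < β + m) :
    ∃ C : ENNReal, C ≠ ⊤ ∧ ∀ x y : E,
      ∫⁻ z, twoScaleKer (finrank ℝ E - 2) β (y - z) * bracketWeight m z *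
        twoScaleKer α β (z - x) ∂μ ≤ C * twoScaleKer α' β (y - x) := by
  set d : ℝ := (finrank ℝ E : ℝ) with hd_def
  obtain ⟨C₁, hC₁, h₁⟩ := exists_lintegral_rieszKer_mul_rieszKer_le μ hd
    (a := d - 2) (b := α) (c := α') (m := m)
    (by linarith) (by linarith) (by linarith) (by linarith) (by linarith) (by linarith)
  obtain ⟨C₂, hC₂, h₂⟩ := exists_lintegral_rieszKer_mul_rieszKer_le μ hd
    (a := d - 2) (b := β) (c := β) (m := m)
    (by linarith) (by linarith) (by linarith) (by linarith) (by linarith) (by linarith)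
  obtain ⟨C₃, hC₃, h₃⟩ := exists_lintegral_rieszKer_mul_rieszKer_le μ hd
    (a := β) (b := α) (c := β) (m := m)
    (by linarith) (by linarith) (by linarith) (by linarith) (by linarith) (by linarith)
  obtain ⟨C₄, hC₄, h₄⟩ := exists_lintegral_rieszKer_mul_rieszKer_le μ hd
    (a := β) (b := β) (c := β) (m := m)
    (by linarith) (by linarith) (by linarith) (by linarith) (by linarith) (by linarith)
  refine ⟨C₁ + C₂ + C₃ + C₄, by finiteness, fun x y => ?_⟩
  have hl : rieszKer α' (y - x) ≤ twoScaleKer α' β (y - x) := le_self_add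
  have hr : rieszKer β (y - x) ≤ twoScaleKer α' β (y - x) := le_add_self
  calc ∫⁻ z, twoScaleKer (d - 2) β (y - z) * bracketWeight m z * twoScaleKer α β (z - x) ∂μ
      = ∫⁻ z, (rieszKer (d - 2) (y - z) * bracketWeight m z * rieszKer α (z - x) +
          rieszKer (d - 2) (y - z) * bracketWeight m z * rieszKer β (z - x) +
          rieszKer β (y - z) * bracketWeight m z * rieszKer α (z - x) +
          rieszKer β (y - z) * bracketWeight m z * rieszKer β (z - x)) ∂μ := by
        refine lintegral_congr fun z => ?_
        unfold twoScaleKer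
        ring
    _ ≤ C₁ * rieszKer α' (y - x) + C₂ * rieszKer β (y - x) + C₃ * rieszKer β (y - x) +
          C₄ * rieszKer β (y - x) := by
        rw [lintegral_add_left (by fun_prop), lintegral_add_left (by fun_prop),
          lintegral_add_left (by fun_prop)]
        gcongr
        exacts [h₁ x y, h₂ x y, h₃ x y, h₄ x y]
    _ ≤ C₁ * twoScaleKer α' β (y - x) + C₂ * twoScaleKer α' β (y - x) +
          C₃ * twoScaleKer α' β (y - x) + C₄ * twoScaleKer α' β (y - x) := by gcongr
    _ = _ := by ring

end Kernels

section Chain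

theorem chainPt_zero {n m : ℕ} (y x : EuclideanSpace ℝ (Fin n))
    (z : Fin m → EuclideanSpace ℝ (Fin n)) : chainPt y x z 0 = y := rfl

theorem chainPt_cons_succ {n m : ℕ} (y x z₀ : EuclideanSpace ℝ (Fin n))
    (z : Fin m → EuclideanSpace ℝ (Fin n)) (j : ℕ) :
    chainPt y x (Fin.cons z₀ z : Fin (m + 1) → EuclideanSpace ℝ (Fin n)) (j + 1) =
      chainPt z₀ x z j := by
  rcases j with _ | j
  · simp [chainPt]
  · by_cases h : j < m
    · have h' : (Fin.cons z₀ z : Fin (m + 1) → EuclideanSpace ℝ (Fin n)) ⟨j + 1, by omega⟩ =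
          z ⟨j, h⟩ := rfl
      simp [chainPt, h, h']
    · simp [chainPt, h]

theorem measurable_chainPt {n m : ℕ} (j : ℕ) :
    Measurable fun p : EuclideanSpace ℝ (Fin n) × EuclideanSpace ℝ (Fin n) ×
      (Fin m → EuclideanSpace ℝ (Fin n)) => chainPt p.1 p.2.1 p.2.2 j := by
  unfold chainPt
  split_ifs <;> fun_prop

@[fun_prop]
theorem Measurable.chainPt {Ω : Type*} [MeasurableSpace Ω] {n m : ℕ}
    {y x : Ω → EuclideanSpace ℝ (Fin n)} {z : Ω → Fin m → EuclideanSpace ℝ (Fin n)}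
    (hy : Measurable y) (hx : Measurable x) (hz : Measurable z) (j : ℕ) :
    Measurable fun ω => _root_.chainPt (y ω) (x ω) (z ω) j :=
  (measurable_chainPt j).comp (hy.prodMk (hx.prodMk hz))

/-- The product of a kernel along the chain and of a weight at its interior points. -/
noncomputable def chainProd {n m : ℕ} (G W : EuclideanSpace ℝ (Fin n) → ENNReal)
    (y x : EuclideanSpace ℝ (Fin n)) (z : Fin m → EuclideanSpace ℝ (Fin n)) : ENNReal :=
  (∏ j ∈ Finset.range (m + 1), G (chainPt y x z j - chainPt y x z (j + 1))) * ∏ j, W (z j)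

theorem chainProd_cons {n m : ℕ} (G W : EuclideanSpace ℝ (Fin n) → ENNReal)
    (y x z₀ : EuclideanSpace ℝ (Fin n)) (z : Fin m → EuclideanSpace ℝ (Fin n)) :
    chainProd G W y x (Fin.cons z₀ z : Fin (m + 1) → EuclideanSpace ℝ (Fin n)) =
      G (y - z₀) * W z₀ * chainProd G W z₀ x z := by
  unfold chainProd
  rw [Finset.prod_range_succ', Fin.prod_univ_succ]
  simp only [chainPt_cons_succ, chainPt_zero, Fin.cons_zero, Fin.cons_succ]
  ring

theorem lintegral_fin_succ {E : Type*} [MeasureSpace E] [SigmaFinite (volume : Measure E)]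
    {m : ℕ} {F : (Fin (m + 1) → E) → ENNReal} (hF : Measurable F) :
    ∫⁻ z, F z = ∫⁻ z₀, ∫⁻ z : Fin m → E, F (Fin.cons z₀ z) := by
  have h := (volume_preserving_piFinSuccAbove (fun _ : Fin (m + 1) => E) 0).symm
  rw [← h.lintegral_comp hF, Measure.volume_eq_prod, lintegral_prod _ (by fun_prop)]
  simp [MeasurableEquiv.piFinSuccAbove, Fin.insertNthEquiv]

theorem lintegral_chainProd_succ {n m : ℕ} {G W : EuclideanSpace ℝ (Fin n) → ENNReal}
    (hG : Measurable G) (hW : Measurable W) (y x : EuclideanSpace ℝ (Fin n)) :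
    ∫⁻ z : Fin (m + 1) → EuclideanSpace ℝ (Fin n), chainProd G W y x z =
      ∫⁻ z₀, G (y - z₀) * W z₀ *
        ∫⁻ z : Fin m → EuclideanSpace ℝ (Fin n), chainProd G W z₀ x z := by
  have hmeas : Measurable fun z : Fin (m + 1) → EuclideanSpace ℝ (Fin n) =>
      chainProd G W y x z := by
    unfold chainProd; fun_prop
  rw [lintegral_fin_succ hmeas]
  refine lintegral_congr fun z₀ => ?_
  simp_rw [chainProd_cons]
  rw [lintegral_const_mul]
  unfold chainProd; fun_prop

theorem lintegral_chainProd_zero {n : ℕ} (G W : EuclideanSpace ℝ (Fin n) → ENNReal)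
    (y x : EuclideanSpace ℝ (Fin n)) :
    ∫⁻ z : Fin 0 → EuclideanSpace ℝ (Fin n), chainProd G W y x z = G (y - x) := by
  simp [chainProd, chainPt, volume_pi]

/-- The iterated two-scale kernel gains almost two powers of local regularity per step. -/
theorem exists_lintegral_chainProd_le {n : ℕ} (hn : 1 ≤ n) {β δ w : ℝ} (hβ : 0 ≤ β)
    (hβn : β ≤ n - 2) (hδ : 0 < δ) (hδ2 : δ ≤ 2) (hw : 2 < w) (hβw : (n : ℝ) < β + w) (m : ℕ) :
    ∃ C : ENNReal, C ≠ ⊤ ∧ ∀ x y : EuclideanSpace ℝ (Fin n),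
      ∫⁻ z : Fin m → EuclideanSpace ℝ (Fin n),
        chainProd (twoScaleKer (n - 2) β) (bracketWeight w) y x z ≤
          C * twoScaleKer (max β (n - 2 - m * (2 - δ))) β (y - x) := by
  induction m with
  | zero =>
    refine ⟨1, by simp, fun x y => ?_⟩
    rw [lintegral_chainProd_zero]
    simp [hβn]
  | succ m ih =>
    obtain ⟨C, hC, hle⟩ := ih
    have hm : (0 : ℝ) ≤ m * (2 - δ) := mul_nonneg (by positivity) (by linarith)
    have hfin : (Module.finrank ℝ (EuclideanSpace ℝ (Fin n)) : ℝ) = n := by simp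
    obtain ⟨C', hC', hle'⟩ := exists_lintegral_twoScaleKer_mul_le
      (volume : Measure (EuclideanSpace ℝ (Fin n))) (by simpa using hn)
      (α := max β (n - 2 - m * (2 - δ))) (α' := max β (n - 2 - (m + 1 : ℕ) * (2 - δ)))
      (β := β) (m := w) hβ (le_max_left _ _)
      (max_le_max le_rfl (by push_cast; linarith))
      (by rw [hfin]; exact max_le hβn (by linarith))
      (by
        rw [sub_lt_iff_lt_add]
        refine max_lt ?_ ?_
        · linarith [le_max_left β ((n : ℝ) - 2 - (m + 1 : ℕ) * (2 - δ))]
        · have := le_max_right β ((n : ℝ) - 2 - (m + 1 : ℕ) * (2 - δ))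
          push_cast at this ⊢
          linarith) hw (by rwa [hfin])
    rw [hfin] at hle'
    refine ⟨C * C', by finiteness, fun x y => ?_⟩
    rw [lintegral_chainProd_succ (by fun_prop) (by fun_prop)]
    calc _ ≤ ∫⁻ z₀, C * (twoScaleKer (n - 2) β (y - z₀) * bracketWeight w z₀ *
            twoScaleKer (max β (n - 2 - m * (2 - δ))) β (z₀ - x)) := by
          refine lintegral_mono fun z₀ => ?_
          rw [mul_left_comm C]
          gcongr
          exact hle x z₀
      _ ≤ C * (C' * twoScaleKer (max β (n - 2 - (m + 1 : ℕ) * (2 - δ))) β (y - x)) := by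
          rw [lintegral_const_mul _ (by fun_prop)]
          gcongr
          exact hle' x y
      _ = _ := by rw [mul_assoc]

end Chain

section Resolvent

/-- Pointwise bound for the resolvent kernel in dimension `2N + 3`. -/
theorem exists_norm_gker_le (N : ℕ) : ∃ K : ℝ, 0 ≤ K ∧ ∀ lam r : ℝ, 0 ≤ lam → 0 ≤ r →
    ‖gker (2 * N + 3) lam r‖ ≤
      K * (1 + lam) ^ N * (r⁻¹ ^ (2 * N + 1) + r⁻¹ ^ (N + 1)) := by
  have h1 : (2 * N + 3 - 3) / 2 = N := by omega
  have h2 : 2 * N + 3 - 2 = 2 * N + 1 := by omega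
  set c : ℕ → ℝ := fun l => (Nat.factorial (2 * N + 3 - 3 - l) : ℝ) /
    ((Nat.factorial l : ℝ) * (Nat.factorial (N - l) : ℝ)) with hc
  refine ⟨|resC (2 * N + 3)| * ∑ l ∈ Finset.range (N + 1), c l * 2 ^ l, by positivity,
    fun lam r hlam hr => ?_⟩
  rcases hr.eq_or_lt with rfl | hr
  · simp [gker, h2]
  have hexp : ‖Complex.exp (Complex.I * lam * r)‖ = 1 := by
    rw [Complex.norm_exp]; simp
  have hterm : ∀ l ∈ Finset.range (N + 1),
      c l * (2 * r * lam) ^ l ≤ c l * 2 ^ l * ((1 + lam) ^ N * (1 + r ^ N)) := by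
    intro l hl
    have hl' : l ≤ N := Nat.lt_succ_iff.1 (Finset.mem_range.1 hl)
    have hlam' : lam ^ l ≤ (1 + lam) ^ N :=
      (pow_le_pow_left₀ hlam (by linarith) l).trans (pow_le_pow_right₀ (by linarith) hl')
    have hr' : r ^ l ≤ 1 + r ^ N := by
      rcases le_total r 1 with h | h
      · linarith [pow_le_one₀ hr.le h (n := l), pow_nonneg hr.le N]
      · linarith [pow_le_pow_right₀ h hl']
    calc c l * (2 * r * lam) ^ l = c l * 2 ^ l * (lam ^ l * r ^ l) := by
          rw [mul_pow, mul_pow]; ring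
      _ ≤ _ := by gcongr
  have hsum : ‖∑ l ∈ Finset.range (N + 1),
      ((Nat.factorial (2 * N + 3 - 3 - l) : ℂ) /
          ((Nat.factorial l : ℂ) * (Nat.factorial (N - l) : ℂ))) *
        ((-2) * Complex.I * (r : ℂ) * (lam : ℂ)) ^ l‖ ≤
      (∑ l ∈ Finset.range (N + 1), c l * 2 ^ l) * ((1 + lam) ^ N * (1 + r ^ N)) := by
    rw [Finset.sum_mul]
    refine (norm_sum_le _ _).trans (Finset.sum_le_sum fun l hl => ?_)
    refine le_of_eq_of_le ?_ (hterm l hl)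
    simp [hc, abs_of_pos hr, abs_of_nonneg hlam]
  have hpow : r⁻¹ ^ (2 * N + 1) * (1 + r ^ N) = r⁻¹ ^ (2 * N + 1) + r⁻¹ ^ (N + 1) := by
    have h3 : r⁻¹ * r = 1 := inv_mul_cancel₀ hr.ne'
    calc r⁻¹ ^ (2 * N + 1) * (1 + r ^ N)
        = r⁻¹ ^ (2 * N + 1) + r⁻¹ ^ (N + 1) * (r⁻¹ * r) ^ N := by rw [mul_pow]; ring
      _ = _ := by rw [h3, one_pow, mul_one]
  rw [gker, h1, h2, norm_mul, norm_div, norm_mul, hexp, mul_one, norm_pow, Complex.norm_real,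
    Complex.norm_real, Real.norm_eq_abs, Real.norm_eq_abs, abs_of_pos hr]
  calc _ ≤ |resC (2 * N + 3)| / r ^ (2 * N + 1) *
        ((∑ l ∈ Finset.range (N + 1), c l * 2 ^ l) * ((1 + lam) ^ N * (1 + r ^ N))) := by
        gcongr
    _ = |resC (2 * N + 3)| * (∑ l ∈ Finset.range (N + 1), c l * 2 ^ l) * (1 + lam) ^ N *
        (r⁻¹ ^ (2 * N + 1) * (1 + r ^ N)) := by
        rw [inv_pow]; ring
    _ = _ := by rw [hpow]

theorem exists_enorm_gker_norm_le (N : ℕ) (E : Type*) [NormedAddCommGroup E] :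
    ∃ K : ENNReal, K ≠ ⊤ ∧ ∀ lam : ℝ, 0 ≤ lam → ∀ v : E,
      ‖gker (2 * N + 3) lam ‖v‖‖ₑ ≤
        K * ENNReal.ofReal ((1 + lam) ^ N) * twoScaleKer (2 * N + 1) (N + 1) v := by
  obtain ⟨K, hK, hle⟩ := exists_norm_gker_le N
  refine ⟨ENNReal.ofReal K, by simp, fun lam hlam v => ?_⟩
  rcases eq_or_ne v 0 with rfl | hv
  · simp [gker]
  have hv' : 0 < ‖v‖ := norm_pos_iff.2 hv
  have hker : twoScaleKer (2 * N + 1) (N + 1) v =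
      ENNReal.ofReal (‖v‖⁻¹ ^ (2 * N + 1) + ‖v‖⁻¹ ^ (N + 1)) := by
    rw [ENNReal.ofReal_add (by positivity) (by positivity), ENNReal.ofReal_pow (by positivity),
      ENNReal.ofReal_pow (by positivity), ENNReal.ofReal_inv_of_pos hv', ofReal_norm,
      twoScaleKer, rieszKer, rieszKer, ← ENNReal.rpow_natCast, ← ENNReal.rpow_natCast]
    push_cast
    rfl
  rw [hker, ← ENNReal.ofReal_mul hK, ← ENNReal.ofReal_mul (by positivity), ← ofReal_norm]
  exact ENNReal.ofReal_le_ofReal (hle lam ‖v‖ hlam hv'.le)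

theorem measurable_gker (n : ℕ) (lam : ℝ) : Measurable (gker n lam) := by
  unfold gker
  fun_prop

theorem measurable_iterIntegrand (n κ : ℕ) {V : EuclideanSpace ℝ (Fin n) → ℝ}
    (hV : Measurable V) (lam : ℝ) (y x : EuclideanSpace ℝ (Fin n)) :
    Measurable (iterIntegrand n κ V lam y x) := by
  have := measurable_gker n lam
  unfold iterIntegrand
  fun_prop

theorem enorm_iterIntegrand_le {n m : ℕ} {V : EuclideanSpace ℝ (Fin n) → ℝ} {lam : ℝ}
    {G W : EuclideanSpace ℝ (Fin n) → ENNReal} {A B : ENNReal}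
    (hG : ∀ v, ‖gker n lam ‖v‖‖ₑ ≤ A * G v) (hW : ∀ v, ‖V v‖ₑ ≤ B * W v)
    (y x : EuclideanSpace ℝ (Fin n)) (z : Fin m → EuclideanSpace ℝ (Fin n)) :
    ‖iterIntegrand n (m + 1) V lam y x z‖ₑ ≤ A ^ (m + 1) * B ^ m * chainProd G W y x z := by
  have h : ‖iterIntegrand n (m + 1) V lam y x z‖ₑ =
      (∏ j ∈ Finset.range (m + 1), ‖gker n lam ‖chainPt y x z j - chainPt y x z (j + 1)‖‖ₑ) *
        ∏ j, ‖V (z j)‖ₑ := by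
    simp only [iterIntegrand, ← ofReal_norm, norm_mul, norm_prod, Complex.norm_real]
    rw [ENNReal.ofReal_mul (by positivity), ENNReal.ofReal_prod_of_nonneg (by simp),
      ENNReal.ofReal_prod_of_nonneg (by simp)]
    simp
  rw [h]
  calc _ ≤ (∏ j ∈ Finset.range (m + 1), A * G (chainPt y x z j - chainPt y x z (j + 1))) *
        ∏ j, B * W (z j) := by
        refine mul_le_mul' (Finset.prod_le_prod' fun j _ => hG _)
          (Finset.prod_le_prod' fun j _ => hW _)
    _ = _ := by
        simp only [chainProd, Finset.prod_mul_distrib, Finset.prod_const, Finset.card_range,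
          Finset.card_univ, Fintype.card_fin]
        ring

/-- The iterated resolvent kernel is absolutely convergent off the diagonal, with the decay of
a single resolvent kernel and no local singularity beyond it. -/
theorem exists_lintegral_enorm_iterIntegrand_le {N κ : ℕ} (hN : 1 ≤ N)
    {V : EuclideanSpace ℝ (Fin (2 * N + 3)) → ℝ} {C₀ ε : ℝ} (hε : 0 < ε)
    (hV : ∀ x, |V x| ≤ C₀ * (1 + ‖x‖) ^ (-(N + 2 + ε))) (hκ : N + 3 ≤ 2 * κ) :
    ∃ C : ENNReal, C ≠ ⊤ ∧ ∀ lam : ℝ, 0 ≤ lam → ∀ y x : EuclideanSpace ℝ (Fin (2 * N + 3)),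
      ∫⁻ z, ‖iterIntegrand (2 * N + 3) κ V lam y x z‖ₑ ≤
        C * ENNReal.ofReal ((1 + lam) ^ (N * κ)) * rieszKer (N + 1) (y - x) := by
  obtain ⟨m, rfl⟩ : ∃ m, κ = m + 1 := ⟨κ - 1, by omega⟩
  obtain ⟨K, hK, hG⟩ := exists_enorm_gker_norm_le N (EuclideanSpace ℝ (Fin (2 * N + 3)))
  have hNr : (1 : ℝ) ≤ N := by exact_mod_cast hN
  have hmr : (N : ℝ) + 3 ≤ 2 * (m + 1) := by exact_mod_cast hκ
  obtain ⟨C, hC, hle⟩ := exists_lintegral_chainProd_le (n := 2 * N + 3) (by omega)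
    (β := N + 1) (δ := 1 / (m + 1)) (w := N + 2 + ε) (by positivity) (by push_cast; linarith)
    (by positivity) (by rw [div_le_iff₀ (by positivity)]; linarith) (by linarith)
    (by push_cast; linarith) m
  have hdim : ((2 * N + 3 : ℕ) : ℝ) - 2 = 2 * N + 1 := by push_cast; ring
  have hmax : max ((N : ℝ) + 1) (2 * N + 1 - m * (2 - 1 / (m + 1))) = N + 1 := by
    refine max_eq_left ?_
    have h : (m : ℝ) * (1 / (m + 1)) ≤ 1 := by
      rw [mul_one_div, div_le_one (by positivity)]; linarith
    linarith
  rw [hdim, hmax] at hle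
  have hW : ∀ v, ‖V v‖ₑ ≤ ENNReal.ofReal C₀ * bracketWeight (N + 2 + ε) v := by
    intro v
    rw [bracketWeight_eq_ofReal, ← ENNReal.ofReal_mul' (by positivity), ← ofReal_norm]
    exact ENNReal.ofReal_le_ofReal (hV v)
  refine ⟨K ^ (m + 1) * ENNReal.ofReal C₀ ^ m * (C * 2), by finiteness,
    fun lam hlam y x => ?_⟩
  calc ∫⁻ z, ‖iterIntegrand (2 * N + 3) (m + 1) V lam y x z‖ₑ
      ≤ ∫⁻ z : Fin m → EuclideanSpace ℝ (Fin (2 * N + 3)),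
          (K * ENNReal.ofReal ((1 + lam) ^ N)) ^ (m + 1) * ENNReal.ofReal C₀ ^ m *
            chainProd (twoScaleKer (2 * N + 1) (N + 1)) (bracketWeight (N + 2 + ε)) y x z :=
        lintegral_mono fun z => enorm_iterIntegrand_le (hG lam hlam) hW y x z
    _ ≤ (K * ENNReal.ofReal ((1 + lam) ^ N)) ^ (m + 1) * ENNReal.ofReal C₀ ^ m *
          (C * twoScaleKer (N + 1) (N + 1) (y - x)) := by
        rw [lintegral_const_mul' _ _ (by finiteness)]
        gcongr
        exact hle x y
    _ = _ := by
        rw [pow_mul, ENNReal.ofReal_pow (p := (1 + lam) ^ N) (by positivity), mul_pow, twoScaleKer]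
        ring

theorem enorm_weight_mul_sq_le {E : Type*} [NormedAddCommGroup E] {s σ : ℝ} {A : ENNReal} {k : ℂ}
    {v y : E} (hk : ‖k‖ₑ ≤ A * rieszKer s v) :
    ‖(1 + ‖y‖) ^ (-(2 * σ)) * ‖k‖ ^ 2‖ₑ ≤
      A ^ 2 * (rieszKer (2 * s) v * bracketWeight (2 * σ) y) := by
  have h2 : rieszKer (2 * s) v = rieszKer s v ^ 2 := by
    rw [rieszKer, rieszKer, mul_comm, ENNReal.rpow_mul, ENNReal.rpow_ofNat]
  rw [enorm_mul, enorm_pow, enorm_norm, Real.enorm_of_nonneg (by positivity),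
    ← bracketWeight_eq_ofReal, h2, mul_comm (rieszKer s v ^ 2), mul_left_comm, ← mul_pow]
  gcongr

end Resolvent

/-- Lemma 2.2 of the paper: for `|V(x)| ≲ ⟨x⟩^{−(n+1)/2−ε}`, `σ > 1/2` and
`κ ≥ (n+3)/4`, the iterated kernel satisfies
`‖⟨·⟩^{−σ} K_λ(·, x)‖_{L²} ≲ ⟨λ⟩^{κ(n−3)/2}` uniformly in `x`. -/
theorem iterated_resolvent_weighted_L2 (n : ℕ) (hn : 5 ≤ n) (hodd : Odd n)
    (V : EuclideanSpace ℝ (Fin n) → ℝ) (hVmeas : Measurable V) (C₀ ε : ℝ) (hε : 0 < ε)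
    (hV : ∀ x, |V x| ≤ C₀ * (1 + ‖x‖) ^ (-((n : ℝ) + 1) / 2 - ε))
    (σ : ℝ) (hσ : 1 / 2 < σ) (κ : ℕ) (hκ : ((n : ℝ) + 3) / 4 ≤ (κ : ℝ)) :
    ∃ C : ℝ, 0 < C ∧ ∀ lam : ℝ, 0 ≤ lam → ∀ x : EuclideanSpace ℝ (Fin n),
      (∀ᵐ y : EuclideanSpace ℝ (Fin n), Integrable (iterIntegrand n κ V lam y x)) ∧
      Real.sqrt (∫ y : EuclideanSpace ℝ (Fin n),
          (1 + ‖y‖) ^ (-(2 * σ)) * ‖iterKernel n κ V lam y x‖ ^ 2) ≤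
        C * (1 + lam) ^ ((κ : ℝ) * ((n : ℝ) - 3) / 2) := by
  obtain ⟨N, rfl⟩ : ∃ N, n = 2 * N + 3 := by
    obtain ⟨k, rfl⟩ := hodd
    exact ⟨k - 1, by omega⟩
  have hN : 1 ≤ N := by omega
  have hNr : (1 : ℝ) ≤ N := by exact_mod_cast hN
  have hκ' : N + 3 ≤ 2 * κ := by
    have h : (N : ℝ) + 3 ≤ 2 * κ := by push_cast at hκ; linarith
    exact_mod_cast h
  have hV' : ∀ x, |V x| ≤ C₀ * (1 + ‖x‖) ^ (-(N + 2 + ε)) := by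
    intro x
    convert hV x using 3
    push_cast
    ring
  obtain ⟨C, hC, hle⟩ := exists_lintegral_enorm_iterIntegrand_le hN hε hV' hκ'
  obtain ⟨M, hM, hMle⟩ := exists_lintegral_rieszKer_mul_bracketWeight_le
    (volume : Measure (EuclideanSpace ℝ (Fin (2 * N + 3)))) (s := 2 * (N + 1)) (m := 2 * σ)
    (by simp) (by positivity) (by simp; linarith) (by linarith) (by simp; linarith)
  refine ⟨C.toReal * √M.toReal + 1, by positivity, fun lam hlam x => ⟨?_, ?_⟩⟩
  · filter_upwards [Measure.ae_ne volume x] with y hy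
    refine ⟨(measurable_iterIntegrand _ κ hVmeas lam y x).aestronglyMeasurable,
      (hle lam hlam y x).trans_lt ?_⟩
    have hpos : ‖y - x‖ₑ⁻¹ ≠ ⊤ := by simpa [sub_eq_zero] using hy
    have hker : rieszKer (N + 1) (y - x) ≠ ⊤ :=
      ENNReal.rpow_ne_top_of_nonneg (by positivity) hpos
    finiteness
  · set P : ℝ := (1 + lam) ^ (N * κ) with hP
    have hP0 : 0 ≤ P := by positivity
    have hpow : (1 + lam) ^ ((κ : ℝ) * (((2 * N + 3 : ℕ) : ℝ) - 3) / 2) = P := by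
      rw [hP, ← Real.rpow_natCast]
      push_cast
      ring_nf
    have hint : ‖∫ y : EuclideanSpace ℝ (Fin (2 * N + 3)),
        (1 + ‖y‖) ^ (-(2 * σ)) * ‖iterKernel (2 * N + 3) κ V lam y x‖ ^ 2‖ₑ ≤
          (C * ENNReal.ofReal P) ^ 2 * M := by
      refine (enorm_integral_le_lintegral_enorm _).trans ?_
      calc _ ≤ ∫⁻ y, (C * ENNReal.ofReal P) ^ 2 *
            (rieszKer (2 * (N + 1)) (y - x) * bracketWeight (2 * σ) y) :=
            lintegral_mono fun y => enorm_weight_mul_sq_le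
              ((enorm_integral_le_lintegral_enorm _).trans (hle lam hlam y x))
        _ ≤ _ := by
            rw [lintegral_const_mul' _ _ (by finiteness)]
            gcongr
            exact hMle x
    have hreal := ENNReal.toReal_mono (by finiteness) hint
    rw [toReal_enorm, ENNReal.toReal_mul, ENNReal.toReal_pow, ENNReal.toReal_mul,
      ENNReal.toReal_ofReal hP0] at hreal
    rw [hpow]
    calc _ ≤ √((C.toReal * P) ^ 2 * M.toReal) :=
          Real.sqrt_le_sqrt ((Real.le_norm_self _).trans hreal)
      _ = C.toReal * √M.toReal * P := by
          rw [Real.sqrt_mul (by positivity), Real.sqrt_sq (by positivity)]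
          ring
      _ ≤ _ := by gcongr; linarith
end

section
/- Let n ≥ 1, let k, ℓ be real numbers with 0 ≤ k < n, 0 ≤ ℓ < n, let β > 0 satisfy k + ℓ + β ≥ n and k + ℓ ≠ n, and fix ε > 0. Then there is a constant C such that for all u₁, u₂ ∈ ℝⁿ with u₁ ≠ u₂: if |u₁ − u₂| ≤ 1 then ∫_{ℝⁿ} ⟨z⟩^{−β−ε} |z − u₁|^{−k} |z − u₂|^{−ℓ} dz ≤ C |u₁ − u₂|^{−max(0, k+ℓ−n)}, and if |u₁ − u₂| > 1 then ∫_{ℝⁿ} ⟨z⟩^{−β−ε} |z − u₁|^{−k} |z − u₂|^{−ℓ} dz ≤ C |u₁ − u₂|^{−min(k, ℓ, k+ℓ+β−n)}. -/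
open MeasureTheory Real Module

lemma integrable_and_integral_le_of_ae_le {α : Type*} [MeasurableSpace α] {μ : Measure α}
    {f g : α → ℝ} (hf : ∀ x, 0 ≤ f x) (hfm : Measurable f) (hg : Integrable g μ)
    (hfg : ∀ᵐ x ∂μ, f x ≤ g x) : Integrable f μ ∧ ∫ x, f x ∂μ ≤ ∫ x, g x ∂μ := by
  refine ⟨hg.mono' hfm.aestronglyMeasurable ?_,
    integral_mono_of_nonneg (.of_forall hf) hg hfg⟩
  filter_upwards [hfg] with x hx
  rwa [Real.norm_of_nonneg (hf x)]

lemma rpow_neg_mul_rpow_neg_le {x y a b : ℝ} (hx : 0 < x) (hxy : x ≤ y) (hb : 0 ≤ b) :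
    x ^ (-a) * y ^ (-b) ≤ x ^ (-(a + b)) := by
  rw [neg_add, rpow_add hx]
  exact mul_le_mul_of_nonneg_left (rpow_le_rpow_of_nonpos hx hxy (by linarith)) (by positivity)

lemma half_rpow_neg (R e : ℝ) (hR : 0 ≤ R) : (R / 2) ^ (-e) = 2 ^ e * R ^ (-e) := by
  rw [div_rpow hR zero_le_two, rpow_neg zero_le_two, div_inv_eq_mul, mul_comm]

section

variable {E : Type*} [NormedAddCommGroup E]

/-- The kernel `⟨z⟩^{-γ} |z - u|^{-k} max(|z - u|, ρ)^{-l}`. -/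
noncomputable def truncKernel (γ k l ρ : ℝ) (u z : E) : ℝ :=
  (1 + ‖z‖) ^ (-γ) * ‖z - u‖ ^ (-k) * max ‖z - u‖ ρ ^ (-l)

lemma truncKernel_nonneg (γ k l ρ : ℝ) (u z : E) : 0 ≤ truncKernel γ k l ρ u z := by
  unfold truncKernel
  have : 0 ≤ max ‖z - u‖ ρ := le_max_of_le_left (norm_nonneg _)
  positivity

lemma measurable_truncKernel [MeasurableSpace E] [BorelSpace E] (γ k l ρ : ℝ) (u : E) :
    Measurable (truncKernel γ k l ρ u) := by
  unfold truncKernel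
  fun_prop

lemma two_point_kernel_le_truncKernel {γ k l : ℝ} (hl : 0 ≤ l) {u₁ u₂ : E} (hu : u₁ ≠ u₂) (z : E)
    (h : ‖z - u₁‖ ≤ ‖z - u₂‖) :
    (1 + ‖z‖) ^ (-γ) * ‖z - u₁‖ ^ (-k) * ‖z - u₂‖ ^ (-l) ≤
      truncKernel γ k l (‖u₁ - u₂‖ / 2) u₁ z := by
  have hR : 0 < ‖u₁ - u₂‖ := norm_pos_iff.2 (sub_ne_zero.2 hu)
  refine mul_le_mul_of_nonneg_left (rpow_le_rpow_of_nonpos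
    (lt_max_of_lt_right (by positivity)) (max_le h ?_) (by linarith)) (by positivity)
  have := norm_sub_le (z - u₂) (z - u₁)
  rw [sub_sub_sub_cancel_left] at this
  linarith

lemma integral_two_point_kernel_le [MeasurableSpace E] {μ : Measure E} {γ k l : ℝ}
    (hk : 0 ≤ k) (hl : 0 ≤ l) {u₁ u₂ : E} (hu : u₁ ≠ u₂)
    (h₁ : Integrable (truncKernel γ k l (‖u₁ - u₂‖ / 2) u₁) μ)
    (h₂ : Integrable (truncKernel γ l k (‖u₁ - u₂‖ / 2) u₂) μ) :
    ∫ z, (1 + ‖z‖) ^ (-γ) * ‖z - u₁‖ ^ (-k) * ‖z - u₂‖ ^ (-l) ∂μ ≤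
      ∫ z, truncKernel γ k l (‖u₁ - u₂‖ / 2) u₁ z ∂μ +
        ∫ z, truncKernel γ l k (‖u₁ - u₂‖ / 2) u₂ z ∂μ := by
  rw [← integral_add h₁ h₂]
  refine integral_mono_of_nonneg (.of_forall fun z => by positivity) (h₁.add h₂)
    (.of_forall fun z => ?_)
  rcases le_total ‖z - u₁‖ ‖z - u₂‖ with h | h
  · exact (two_point_kernel_le_truncKernel hl hu z h).trans
      (le_add_of_nonneg_right (truncKernel_nonneg ..))
  · refine le_add_of_nonneg_of_le (truncKernel_nonneg ..) ?_
    have := two_point_kernel_le_truncKernel (γ := γ) (k := l) hk hu.symm z h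
    rw [norm_sub_rev u₂ u₁] at this
    simpa only [mul_right_comm] using this

end

section

variable {E : Type*} [NormedAddCommGroup E] [NormedSpace ℝ E] [FiniteDimensional ℝ E]
  [MeasurableSpace E] [BorelSpace E]

lemma integrable_norm_rpow_mul_max_one [Nontrivial E] (μ : Measure E) [μ.IsAddHaarMeasure]
    {s t : ℝ} (hs : s < finrank ℝ E) (hst : finrank ℝ E < s + t) :
    Integrable (fun x : E => ‖x‖ ^ (-s) * max ‖x‖ 1 ^ (-t)) μ := by
  rw [integrable_fun_norm_addHaar μ (f := fun y => y ^ (-s) * max y 1 ^ (-t)),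
    ← Set.Ioc_union_Ioi_eq_Ioi zero_le_one, integrableOn_union]
  have hpos : 1 ≤ finrank ℝ E := finrank_pos
  have hcast : ((finrank ℝ E - 1 : ℕ) : ℝ) = finrank ℝ E - 1 := by push_cast [hpos]; ring
  constructor
  · have h : IntegrableOn (fun y : ℝ => y ^ ((finrank ℝ E : ℝ) - 1 - s)) (Set.Ioc 0 1) :=
      (intervalIntegral.intervalIntegrable_rpow' (by linarith)).1
    refine h.congr_fun (fun y hy => ?_) measurableSet_Ioc
    simp only [smul_eq_mul]
    rw [max_eq_right hy.2, one_rpow, mul_one, ← rpow_natCast, ← rpow_add hy.1, hcast]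
    ring_nf
  · have h : IntegrableOn (fun y : ℝ => y ^ ((finrank ℝ E : ℝ) - 1 - s - t)) (Set.Ioi 1) :=
      integrableOn_Ioi_rpow_of_lt (by linarith) one_pos
    refine h.congr_fun (fun y hy => ?_) measurableSet_Ioi
    have hy1 : (1 : ℝ) < y := hy
    have hy0 : 0 < y := by linarith
    simp only [smul_eq_mul]
    rw [max_eq_left hy1.le, ← rpow_natCast, ← rpow_add hy0, ← rpow_add hy0, hcast]
    ring_nf

lemma integral_norm_rpow_mul_max [Nontrivial E] (μ : Measure E) [μ.IsAddHaarMeasure]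
    {s t : ℝ} (hs : s < finrank ℝ E) (hst : finrank ℝ E < s + t) {ρ : ℝ} (hρ : 0 < ρ) (u : E) :
    Integrable (fun x : E => ‖x - u‖ ^ (-s) * max ‖x - u‖ ρ ^ (-t)) μ ∧
    ∫ x, ‖x - u‖ ^ (-s) * max ‖x - u‖ ρ ^ (-t) ∂μ =
      ρ ^ ((finrank ℝ E : ℝ) - s - t) * ∫ x, ‖x‖ ^ (-s) * max ‖x‖ 1 ^ (-t) ∂μ := by
  have hscale : (fun x : E => ‖x‖ ^ (-s) * max ‖x‖ ρ ^ (-t)) =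
      fun x => ρ ^ (-s - t) * (‖ρ⁻¹ • x‖ ^ (-s) * max ‖ρ⁻¹ • x‖ 1 ^ (-t)) := by
    ext x
    have hmax : max ‖x‖ ρ = ρ * max (ρ⁻¹ * ‖x‖) 1 := by
      rw [mul_max_of_nonneg _ _ hρ.le, mul_inv_cancel_left₀ hρ.ne', mul_one]
    have hx : ‖x‖ ^ (-s) = ρ ^ (-s) * (ρ⁻¹ * ‖x‖) ^ (-s) := by
      rw [← mul_rpow hρ.le (by positivity), mul_inv_cancel_left₀ hρ.ne']
    rw [norm_smul, Real.norm_of_nonneg (by positivity : 0 ≤ ρ⁻¹), hmax, hx,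
      mul_rpow hρ.le (by positivity), sub_eq_add_neg, rpow_add hρ]
    ring
  have hint := integrable_norm_rpow_mul_max_one μ hs hst
  refine ⟨Integrable.comp_sub_right (f := fun x : E => ‖x‖ ^ (-s) * max ‖x‖ ρ ^ (-t)) ?_ u, ?_⟩
  · rw [hscale]
    exact (hint.comp_smul (inv_ne_zero hρ.ne')).const_mul _
  · rw [integral_sub_right_eq_self (fun x : E => ‖x‖ ^ (-s) * max ‖x‖ ρ ^ (-t)) u, hscale,
      integral_const_mul,
      Measure.integral_comp_inv_smul μ (fun x : E => ‖x‖ ^ (-s) * max ‖x‖ 1 ^ (-t)) ρ,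
      abs_of_pos (by positivity), smul_eq_mul, ← mul_assoc, ← rpow_natCast, ← rpow_add hρ]
    ring_nf

lemma integral_one_add_norm_rpow_mul_norm_sub_rpow_le [Nontrivial E] (μ : Measure E)
    [μ.IsAddHaarMeasure] {γ b : ℝ} (hb0 : 0 ≤ b) (hb : b < finrank ℝ E)
    (hsum : finrank ℝ E < γ + b) :
    ∃ C, ∀ u : E, Integrable (fun z : E => (1 + ‖z‖) ^ (-γ) * ‖z - u‖ ^ (-b)) μ ∧
      ∫ z, (1 + ‖z‖) ^ (-γ) * ‖z - u‖ ^ (-b) ∂μ ≤ C := by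
  refine ⟨∫ z, (1 + ‖z‖) ^ (-(γ + b)) ∂μ + ∫ x, ‖x‖ ^ (-b) * max ‖x‖ 1 ^ (-γ) ∂μ,
    fun u => ?_⟩
  have h₁ : Integrable (fun z : E => (1 + ‖z‖) ^ (-(γ + b))) μ := integrable_one_add_norm hsum
  obtain ⟨h₂, h₂'⟩ := integral_norm_rpow_mul_max μ hb (by linarith : _ < b + γ) one_pos u
  rw [one_rpow, one_mul] at h₂'
  rw [← h₂', ← integral_add h₁ h₂]
  refine integrable_and_integral_le_of_ae_le (fun z => by positivity) (by fun_prop)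
    (h₁.add h₂) ?_
  filter_upwards [μ.ae_ne u] with z hz
  have hw : 0 < ‖z - u‖ := norm_pos_iff.2 (sub_ne_zero.2 hz)
  rcases le_total (1 + ‖z‖) ‖z - u‖ with h | h
  · exact (rpow_neg_mul_rpow_neg_le (by positivity) h hb0).trans
      (le_add_of_nonneg_right (by positivity))
  · refine le_add_of_nonneg_of_le (by positivity) ?_
    rw [mul_comm]
    refine mul_le_mul_of_nonneg_left (rpow_le_rpow_of_nonpos (by positivity) ?_ (by linarith))
      (by positivity)
    exact max_le h (by linarith [norm_nonneg z])

lemma integral_truncKernel_le_of_add_lt [Nontrivial E] (μ : Measure E) [μ.IsAddHaarMeasure]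
    {γ k l : ℝ} (hk : 0 ≤ k) (hl : 0 ≤ l) (hkl : k + l < finrank ℝ E)
    (hsum : finrank ℝ E < γ + k + l) :
    ∃ C, ∀ (u : E) (ρ : ℝ), Integrable (truncKernel γ k l ρ u) μ ∧
      ∫ z, truncKernel γ k l ρ u z ∂μ ≤ C := by
  obtain ⟨C, hC⟩ := integral_one_add_norm_rpow_mul_norm_sub_rpow_le μ (γ := γ)
    (by linarith : 0 ≤ k + l) hkl (by linarith)
  refine ⟨C, fun u ρ => ?_⟩
  obtain ⟨h₁, h₂⟩ := integrable_and_integral_le_of_ae_le (truncKernel_nonneg γ k l ρ u)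
    (measurable_truncKernel γ k l ρ u) (hC u).1 <| by
      filter_upwards [μ.ae_ne u] with z hz
      have hw : 0 < ‖z - u‖ := norm_pos_iff.2 (sub_ne_zero.2 hz)
      rw [truncKernel, mul_assoc]
      exact mul_le_mul_of_nonneg_left (rpow_neg_mul_rpow_neg_le hw (le_max_left _ _) hl)
        (by positivity)
  exact ⟨h₁, h₂.trans (hC u).2⟩

lemma integral_truncKernel_le_of_lt_add [Nontrivial E] (μ : Measure E) [μ.IsAddHaarMeasure]
    {γ k l : ℝ} (hγ : 0 ≤ γ) (hk : k < finrank ℝ E) (hkl : finrank ℝ E < k + l) :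
    ∃ C, ∀ (u : E) (ρ : ℝ), 0 < ρ → Integrable (truncKernel γ k l ρ u) μ ∧
      ∫ z, truncKernel γ k l ρ u z ∂μ ≤ C * ρ ^ (-(k + l - finrank ℝ E)) := by
  refine ⟨∫ x, ‖x‖ ^ (-k) * max ‖x‖ 1 ^ (-l) ∂μ, fun u ρ hρ => ?_⟩
  obtain ⟨h, h'⟩ := integral_norm_rpow_mul_max μ hk hkl hρ u
  rw [show -(k + l - (finrank ℝ E : ℝ)) = finrank ℝ E - k - l by ring, mul_comm, ← h']
  refine integrable_and_integral_le_of_ae_le (truncKernel_nonneg γ k l ρ u)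
    (measurable_truncKernel γ k l ρ u) h (.of_forall fun z => ?_)
  rw [truncKernel, mul_assoc]
  refine mul_le_of_le_one_left (by positivity) ?_
  exact rpow_le_one_of_one_le_of_nonpos (by linarith [norm_nonneg z]) (by linarith)

lemma integral_truncKernel_le_rpow_neg [Nontrivial E] (μ : Measure E) [μ.IsAddHaarMeasure]
    {γ k l : ℝ} (hk0 : 0 ≤ k) (hk : k < finrank ℝ E) (hl : 0 ≤ l)
    (hsum : finrank ℝ E < γ + k) :
    ∃ C, ∀ (u : E) (ρ : ℝ), 0 < ρ → Integrable (truncKernel γ k l ρ u) μ ∧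
      ∫ z, truncKernel γ k l ρ u z ∂μ ≤ C * ρ ^ (-l) := by
  obtain ⟨C, hC⟩ := integral_one_add_norm_rpow_mul_norm_sub_rpow_le μ hk0 hk hsum
  refine ⟨C, fun u ρ hρ => ?_⟩
  obtain ⟨h₁, h₂⟩ := integrable_and_integral_le_of_ae_le (truncKernel_nonneg γ k l ρ u)
    (measurable_truncKernel γ k l ρ u) ((hC u).1.mul_const (ρ ^ (-l))) (.of_forall fun z =>
      mul_le_mul_of_nonneg_left (rpow_le_rpow_of_nonpos hρ (le_max_right _ _) (by linarith))
        (by positivity))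
  refine ⟨h₁, h₂.trans ?_⟩
  rw [integral_mul_const]
  exact mul_le_mul_of_nonneg_right (hC u).2 (by positivity)

lemma integral_truncKernel_le_rpow [Nontrivial E] (μ : Measure E) [μ.IsAddHaarMeasure]
    {γ k l : ℝ} (hγ : 0 ≤ γ) (hk : 0 ≤ k) (hγk : γ + k < finrank ℝ E)
    (hsum : finrank ℝ E < γ + k + l) :
    ∃ C, ∀ (u : E) (ρ : ℝ), 0 < ρ → Integrable (truncKernel γ k l ρ u) μ ∧
      ∫ z, truncKernel γ k l ρ u z ∂μ ≤ C * ρ ^ (-(k + l + γ - finrank ℝ E)) := by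
  refine ⟨2 * ∫ x, ‖x‖ ^ (-(γ + k)) * max ‖x‖ 1 ^ (-l) ∂μ, fun u ρ hρ => ?_⟩
  obtain ⟨h₀, h₀'⟩ := integral_norm_rpow_mul_max μ hγk hsum hρ (0 : E)
  obtain ⟨h₁, h₁'⟩ := integral_norm_rpow_mul_max μ hγk hsum hρ u
  simp only [sub_zero] at h₀ h₀'
  refine (integrable_and_integral_le_of_ae_le (truncKernel_nonneg γ k l ρ u)
    (measurable_truncKernel γ k l ρ u) (h₀.add h₁) ?_).imp_right fun h => h.trans_eq ?_
  · filter_upwards [μ.ae_ne u, μ.ae_ne 0] with z hz hz0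
    have hw : 0 < ‖z - u‖ := norm_pos_iff.2 (sub_ne_zero.2 hz)
    have hz' : 0 < ‖z‖ := norm_pos_iff.2 hz0
    have hbr : (1 + ‖z‖) ^ (-γ) ≤ ‖z‖ ^ (-γ) :=
      rpow_le_rpow_of_nonpos hz' (by linarith) (by linarith)
    have hmax : 0 < max ‖z - u‖ ρ := lt_max_of_lt_right hρ
    have hmax₀ : 0 < max ‖z‖ ρ := lt_max_of_lt_right hρ
    simp only [Pi.add_apply]
    rw [truncKernel]
    rcases le_total ‖z‖ ‖z - u‖ with h | h
    · refine le_add_of_le_of_nonneg ?_ (by positivity)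
      refine mul_le_mul ?_ (rpow_le_rpow_of_nonpos hmax₀ (max_le_max_right _ h) (by linarith))
        (by positivity) (by positivity)
      exact (mul_le_mul_of_nonneg_right hbr (by positivity)).trans
        (rpow_neg_mul_rpow_neg_le hz' h hk)
    · refine le_add_of_nonneg_of_le (by positivity) ?_
      refine mul_le_mul_of_nonneg_right ?_ (by positivity)
      refine (mul_le_mul_of_nonneg_right hbr (by positivity)).trans ?_
      rw [mul_comm, add_comm γ k]
      exact rpow_neg_mul_rpow_neg_le hw h hγ
  · simp only [Pi.add_apply]
    rw [integral_add h₀ h₁, h₀', h₁',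
      show -(k + l + γ - (finrank ℝ E : ℝ)) = finrank ℝ E - (γ + k) - l by ring]
    ring

lemma integral_truncKernel_half_le_of_le_one [Nontrivial E] (μ : Measure E) [μ.IsAddHaarMeasure]
    {γ k l : ℝ} (hγ : 0 ≤ γ) (hk0 : 0 ≤ k) (hk : k < finrank ℝ E) (hl : 0 ≤ l)
    (hne : k + l ≠ finrank ℝ E) (hsum : finrank ℝ E < γ + k + l) :
    ∃ C, ∀ (u : E) (R : ℝ), 0 < R → Integrable (truncKernel γ k l (R / 2) u) μ ∧
      ∫ z, truncKernel γ k l (R / 2) u z ∂μ ≤ C * R ^ (-(max 0 (k + l - finrank ℝ E))) := by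
  rcases hne.lt_or_gt with h | h
  · obtain ⟨C, hC⟩ := integral_truncKernel_le_of_add_lt μ hk0 hl h hsum
    refine ⟨C, fun u R _ => ?_⟩
    rw [max_eq_left (by linarith), neg_zero, rpow_zero, mul_one]
    exact hC u _
  · obtain ⟨C, hC⟩ := integral_truncKernel_le_of_lt_add μ hγ hk h
    refine ⟨C * 2 ^ (k + l - (finrank ℝ E : ℝ)), fun u R hR => ?_⟩
    rw [max_eq_right (by linarith), mul_assoc, ← half_rpow_neg _ _ hR.le]
    exact hC u _ (by positivity)

lemma integral_truncKernel_half_le_of_one_le [Nontrivial E] (μ : Measure E) [μ.IsAddHaarMeasure]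
    {β ε k l : ℝ} (hβ : 0 ≤ β) (hε : 0 < ε) (hk0 : 0 ≤ k) (hk : k < finrank ℝ E) (hl : 0 ≤ l)
    (hsum : finrank ℝ E ≤ k + l + β) :
    ∃ C, ∀ (u : E) (R : ℝ), 1 ≤ R → Integrable (truncKernel (β + ε) k l (R / 2) u) μ ∧
      ∫ z, truncKernel (β + ε) k l (R / 2) u z ∂μ ≤
        C * R ^ (-(min (min k l) (k + l + β - finrank ℝ E))) := by
  suffices ∃ C e, min (min k l) (k + l + β - finrank ℝ E) ≤ e ∧ ∀ (u : E) (ρ : ℝ), 0 < ρ →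
      Integrable (truncKernel (β + ε) k l ρ u) μ ∧
        ∫ z, truncKernel (β + ε) k l ρ u z ∂μ ≤ C * ρ ^ (-e) by
    obtain ⟨C, e, he, hC⟩ := this
    refine ⟨|C| * 2 ^ e, fun u R hR => ?_⟩
    refine (hC u (R / 2) (by positivity)).imp_right fun h => h.trans ?_
    rw [half_rpow_neg _ _ (by positivity), mul_assoc]
    refine mul_le_mul (le_abs_self C) ?_ (by positivity) (by positivity)
    exact mul_le_mul_of_nonneg_left (rpow_le_rpow_of_exponent_le hR (by linarith))
      (by positivity)
  rcases lt_or_ge (finrank ℝ E : ℝ) (β + ε + k) with h | h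
  · obtain ⟨C, hC⟩ := integral_truncKernel_le_rpow_neg μ hk0 hk hl h
    exact ⟨C, l, (min_le_left _ _).trans (min_le_right _ _), hC⟩
  · obtain ⟨C, hC⟩ := integral_truncKernel_le_rpow μ (l := l) (by linarith : 0 ≤ β + ε / 2) hk0
      (by linarith) (by linarith)
    refine ⟨C, k + l + (β + ε / 2) - finrank ℝ E,
      (min_le_right _ _).trans (by linarith), fun u ρ hρ => ?_⟩
    refine (integrable_and_integral_le_of_ae_le (truncKernel_nonneg _ k l ρ u)
      (measurable_truncKernel _ k l ρ u) (hC u ρ hρ).1 (.of_forall fun z => ?_)).imp_right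
      fun h' => h'.trans (hC u ρ hρ).2
    have : 0 < max ‖z - u‖ ρ := lt_max_of_lt_right hρ
    unfold truncKernel
    gcongr
    · linarith [norm_nonneg z]
    · linarith

end

/-- Lemma 6.1 of the paper: for `0 ≤ k, ℓ < n`, `β > 0` with `k + ℓ + β ≥ n` and
`k + ℓ ≠ n`, the integral `∫ ⟨z⟩^{−β−ε} |z−u₁|^{−k} |z−u₂|^{−ℓ} dz` is bounded by
`C |u₁−u₂|^{−max(0,k+ℓ−n)}` when `|u₁−u₂| ≤ 1`, and by
`C |u₁−u₂|^{−min(k,ℓ,k+ℓ+β−n)}` when `|u₁−u₂| > 1`. -/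
theorem iterated_integral_estimate (n : ℕ) (hn : 1 ≤ n) (k l β ε : ℝ)
    (hk0 : 0 ≤ k) (hkn : k < n) (hl0 : 0 ≤ l) (hln : l < n)
    (hβ : 0 < β) (hsum : (n : ℝ) ≤ k + l + β) (hne : k + l ≠ n) (hε : 0 < ε) :
    ∃ C : ℝ, 0 < C ∧ ∀ u1 u2 : EuclideanSpace ℝ (Fin n), u1 ≠ u2 →
      (‖u1 - u2‖ ≤ 1 →
        (∫ z : EuclideanSpace ℝ (Fin n),
            (1 + ‖z‖) ^ (-β - ε) * ‖z - u1‖ ^ (-k) * ‖z - u2‖ ^ (-l)) ≤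
          C * ‖u1 - u2‖ ^ (-(max 0 (k + l - n)))) ∧
      (1 < ‖u1 - u2‖ →
        (∫ z : EuclideanSpace ℝ (Fin n),
            (1 + ‖z‖) ^ (-β - ε) * ‖z - u1‖ ^ (-k) * ‖z - u2‖ ^ (-l)) ≤
          C * ‖u1 - u2‖ ^ (-(min (min k l) (k + l + β - n)))) := by
  have : Nonempty (Fin n) := ⟨⟨0, hn⟩⟩
  have hfin : Module.finrank ℝ (EuclideanSpace ℝ (Fin n)) = n := finrank_euclideanSpace_fin
  obtain ⟨A, hA⟩ := integral_truncKernel_half_le_of_le_one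
    (volume : Measure (EuclideanSpace ℝ (Fin n))) (γ := β + ε) (k := k) (l := l)
    (by linarith) hk0 (by rwa [hfin]) hl0 (by rwa [hfin]) (by rw [hfin]; linarith)
  obtain ⟨A', hA'⟩ := integral_truncKernel_half_le_of_le_one
    (volume : Measure (EuclideanSpace ℝ (Fin n))) (γ := β + ε) (k := l) (l := k)
    (by linarith) hl0 (by rwa [hfin]) hk0 (by rwa [hfin, add_comm]) (by rw [hfin]; linarith)
  obtain ⟨B, hB⟩ := integral_truncKernel_half_le_of_one_le
    (volume : Measure (EuclideanSpace ℝ (Fin n))) (k := k) (l := l)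
    hβ.le hε hk0 (by rwa [hfin]) hl0 (by rwa [hfin])
  obtain ⟨B', hB'⟩ := integral_truncKernel_half_le_of_one_le
    (volume : Measure (EuclideanSpace ℝ (Fin n))) (k := l) (l := k)
    hβ.le hε hl0 (by rwa [hfin]) hk0 (by rw [hfin]; linarith)
  rw [hfin] at hA hA' hB hB'
  rw [add_comm l k] at hA' hB'
  rw [min_comm l k] at hB'
  refine ⟨max (max (A + A') (B + B')) 1, by positivity, fun u1 u2 hu => ?_⟩
  have hR : 0 < ‖u1 - u2‖ := norm_pos_iff.2 (sub_ne_zero.2 hu)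
  rw [← neg_add']
  refine ⟨fun _ => ?_, fun h => ?_⟩
  · obtain ⟨h₁, h₁'⟩ := hA u1 _ hR
    obtain ⟨h₂, h₂'⟩ := hA' u2 _ hR
    refine (integral_two_point_kernel_le hk0 hl0 hu h₁ h₂).trans
      ((add_le_add h₁' h₂').trans ?_)
    rw [← add_mul]
    exact mul_le_mul_of_nonneg_right ((le_max_left _ _).trans (le_max_left _ _)) (by positivity)
  · obtain ⟨h₁, h₁'⟩ := hB u1 _ h.le
    obtain ⟨h₂, h₂'⟩ := hB' u2 _ h.le
    refine (integral_two_point_kernel_le hk0 hl0 hu h₁ h₂).trans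
      ((add_le_add h₁' h₂').trans ?_)
    rw [← add_mul]
    exact mul_le_mul_of_nonneg_right ((le_max_right _ _).trans (le_max_left _ _)) (by positivity)
end

section
/- Let n ≥ 5 be odd and let χ : ℝ → ℝ be a smooth function with χ(λ) = 1 for λ ≤ λ₁/2 and χ(λ) = 0 for λ ≥ λ₁, where 0 < λ₁ ≤ 1 is fixed. Then there is a constant C (depending on n and χ) such that for all real t ≠ 0: sup_{x, y ∈ ℝⁿ, x ≠ y} | ∫₀^∞ e^{i t λ²} λ χ(λ) [ g_n(λ, |x−y|) − g_n(−λ, |x−y|) ] dλ | ≤ C |t|^{−n/2}. (This is the dispersive bound for the low-energy part of the free Schrödinger evolution, since g_n(λ, |x−y|) − g_n(−λ, |x−y|) is the kernel of the difference of the two limiting free resolvents R₀⁺(λ²) − R₀⁻(λ²).) -/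
open MeasureTheory Complex Real Finset

/-- The Fresnel integral is bounded on `[0, ∞)`. -/
lemma norm_fresnel_le_of_nonneg {X : ℝ} (hX : 0 ≤ X) :
    ‖∫ u in (0:ℝ)..X, Complex.exp (Complex.I * (u : ℂ) ^ 2)‖ ≤ 2 := by
  have hnorm : ∀ u : ℝ, ‖Complex.exp (Complex.I * (u : ℂ) ^ 2)‖ = 1 := by
    intro u
    rw [mul_comm, ← Complex.ofReal_pow, Complex.norm_exp_ofReal_mul_I]
  have hcont : Continuous fun u : ℝ => Complex.exp (Complex.I * (u : ℂ) ^ 2) := by fun_prop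
  rcases le_total X 1 with h | h
  · have := intervalIntegral.norm_integral_le_of_norm_le_const (a := 0) (b := X)
      (f := fun u : ℝ => Complex.exp (Complex.I * (u : ℂ) ^ 2)) (C := 1)
      (fun u _ => (hnorm u).le)
    rw [sub_zero, abs_of_nonneg hX] at this
    linarith
  · rw [← intervalIntegral.integral_add_adjacent_intervals (b := 1)
      (hcont.intervalIntegrable _ _) (hcont.intervalIntegrable _ _)]
    have h1 : ‖∫ u in (0:ℝ)..1, Complex.exp (Complex.I * (u : ℂ) ^ 2)‖ ≤ 1 := by
      have := intervalIntegral.norm_integral_le_of_norm_le_const (a := 0) (b := 1)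
        (f := fun u : ℝ => Complex.exp (Complex.I * (u : ℂ) ^ 2)) (C := 1)
        (fun u _ => (hnorm u).le)
      simpa using this
    have hpos : ∀ u ∈ Set.uIcc 1 X, 0 < u := by
      intro u hu
      rw [Set.uIcc_of_le h] at hu
      linarith [hu.1]
    have hd : ∀ u ∈ Set.uIcc 1 X, HasDerivAt
        (fun u : ℝ => Complex.exp (Complex.I * (u : ℂ) ^ 2) / (2 * Complex.I * u))
        (Complex.exp (Complex.I * (u : ℂ) ^ 2)
          - Complex.exp (Complex.I * (u : ℂ) ^ 2) / (2 * Complex.I * (u : ℂ) ^ 2)) u := by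
      intro u hu
      have hu0 : (u : ℂ) ≠ 0 := by exact_mod_cast (hpos u hu).ne'
      have hid : HasDerivAt (fun u : ℝ => (u : ℂ)) 1 u := Complex.ofRealCLM.hasDerivAt
      have h2 := (((hid.pow 2).const_mul Complex.I).cexp).div (hid.const_mul (2 * Complex.I))
        (by simp [hu0])
      refine h2.congr_deriv ?_
      simp only [Pi.pow_apply]
      have hI : Complex.I ≠ 0 := Complex.I_ne_zero
      field_simp
      push_cast
      ring
    have hc2 : ContinuousOn (fun u : ℝ =>
        Complex.exp (Complex.I * (u : ℂ) ^ 2) / (2 * Complex.I * (u : ℂ) ^ 2))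
        (Set.uIcc 1 X) := by
      refine hcont.continuousOn.div (by fun_prop) fun u hu => ?_
      have hu0 : (u : ℂ) ≠ 0 := by exact_mod_cast (hpos u hu).ne'
      simp [hu0]
    have hF := intervalIntegral.integral_eq_sub_of_hasDerivAt hd
      (hcont.continuousOn.sub hc2).intervalIntegrable
    rw [intervalIntegral.integral_sub (hcont.intervalIntegrable _ _) hc2.intervalIntegrable] at hF
    have hinv : ∫ u in (1:ℝ)..X, (1 / 2) * (u ^ 2)⁻¹ = 1 / 2 - 1 / (2 * X) := by
      have hd' : ∀ u ∈ Set.uIcc 1 X, HasDerivAt (fun u : ℝ => -(1 / 2) * u⁻¹)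
          ((1 / 2) * (u ^ 2)⁻¹) u := by
        intro u hu
        refine ((hasDerivAt_inv (hpos u hu).ne').const_mul (-(1 / 2) : ℝ)).congr_deriv ?_
        ring
      rw [intervalIntegral.integral_eq_sub_of_hasDerivAt hd']
      · have : X ≠ 0 := by linarith
        field_simp
        ring
      · refine ContinuousOn.intervalIntegrable ?_
        exact continuousOn_const.mul ((continuousOn_id.pow 2).inv₀
          fun u hu => (pow_pos (hpos u hu) 2).ne')
    have h3 : ‖∫ u in (1:ℝ)..X,
        Complex.exp (Complex.I * (u : ℂ) ^ 2) / (2 * Complex.I * (u : ℂ) ^ 2)‖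
          ≤ 1 / 2 - 1 / (2 * X) := by
      rw [← hinv]
      refine (intervalIntegral.norm_integral_le_integral_norm h).trans (le_of_eq ?_)
      refine intervalIntegral.integral_congr fun u hu => ?_
      simp only [norm_div, hnorm, norm_mul, Complex.norm_I, norm_pow, Complex.norm_real,
        Real.norm_eq_abs, sq_abs, Complex.norm_ofNat]
      rw [mul_one, one_div, mul_inv]
      ring
    have h4 : ‖Complex.exp (Complex.I * (X : ℂ) ^ 2) / (2 * Complex.I * X)‖ = 1 / (2 * X) := by
      rw [norm_div, hnorm, norm_mul, norm_mul, Complex.norm_I, Complex.norm_real,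
        Real.norm_eq_abs, abs_of_nonneg hX, Complex.norm_ofNat, mul_one]
    have h5 : ‖Complex.exp (Complex.I * ((1:ℝ) : ℂ) ^ 2) / (2 * Complex.I * (1:ℝ))‖ = 1 / 2 := by
      rw [norm_div, hnorm, norm_mul, norm_mul, Complex.norm_I, Complex.norm_real,
        norm_one, Complex.norm_ofNat, mul_one, mul_one]
    have h6 := sub_eq_iff_eq_add.mp hF
    rw [h6]
    refine (norm_add_le _ _).trans ?_
    have h7 := norm_add_le (Complex.exp (Complex.I * (X : ℂ) ^ 2) / (2 * Complex.I * X)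
      - Complex.exp (Complex.I * ((1:ℝ) : ℂ) ^ 2) / (2 * Complex.I * (1:ℝ)))
      (∫ u in (1:ℝ)..X, Complex.exp (Complex.I * (u : ℂ) ^ 2) / (2 * Complex.I * (u : ℂ) ^ 2))
    have h8 := norm_sub_le (Complex.exp (Complex.I * (X : ℂ) ^ 2) / (2 * Complex.I * X))
      (Complex.exp (Complex.I * ((1:ℝ) : ℂ) ^ 2) / (2 * Complex.I * (1:ℝ)))
    linarith

lemma norm_fresnel_le (X : ℝ) :
    ‖∫ u in (0:ℝ)..X, Complex.exp (Complex.I * (u : ℂ) ^ 2)‖ ≤ 2 := by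
  rcases le_total 0 X with h | h
  · exact norm_fresnel_le_of_nonneg h
  · have h1 := intervalIntegral.integral_comp_neg (a := 0) (b := X)
      (fun u : ℝ => Complex.exp (Complex.I * (u : ℂ) ^ 2))
    simp only [Complex.ofReal_neg, neg_sq, neg_zero] at h1
    rw [h1, intervalIntegral.integral_symm, norm_neg]
    exact norm_fresnel_le_of_nonneg (by linarith)

lemma norm_integral_exp_quadratic_le_of_pos {t : ℝ} (ht : 0 < t) (a x : ℝ) :
    ‖∫ u in (0:ℝ)..x, Complex.exp (Complex.I * ((t * u ^ 2 + a * u : ℝ) : ℂ))‖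
      ≤ 4 / √t := by
  have hs : 0 < √t := Real.sqrt_pos.mpr ht
  have hsq : √t ^ 2 = t := Real.sq_sqrt ht.le
  have hcont : Continuous fun u : ℝ => Complex.exp (Complex.I * (u : ℂ) ^ 2) := by fun_prop
  have key : ∀ u : ℝ, Complex.exp (Complex.I * ((t * u ^ 2 + a * u : ℝ) : ℂ))
      = Complex.exp (Complex.I * ((-(a ^ 2 / (4 * t)) : ℝ) : ℂ)) *
        Complex.exp (Complex.I * ((√t * u + a / (2 * √t) : ℝ) : ℂ) ^ 2) := by
    intro u
    rw [← Complex.exp_add, ← Complex.ofReal_pow, ← mul_add, ← Complex.ofReal_add]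
    congr 3
    rw [add_sq, mul_pow, div_pow, mul_pow, hsq]
    field_simp
    ring
  simp_rw [key]
  rw [intervalIntegral.integral_const_mul, norm_mul, mul_comm Complex.I,
    Complex.norm_exp_ofReal_mul_I, one_mul,
    intervalIntegral.integral_comp_mul_add
      (fun v : ℝ => Complex.exp (Complex.I * (v : ℂ) ^ 2)) hs.ne',
    ← intervalIntegral.integral_interval_sub_left (a := 0)
      (hcont.intervalIntegrable _ _) (hcont.intervalIntegrable _ _), norm_smul,
    norm_inv, Real.norm_eq_abs, abs_of_pos hs, div_eq_inv_mul 4]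
  refine mul_le_mul_of_nonneg_left ?_ (inv_nonneg.mpr hs.le)
  refine (norm_sub_le _ _).trans ?_
  linarith [norm_fresnel_le (√t * x + a / (2 * √t)), norm_fresnel_le (√t * 0 + a / (2 * √t))]

lemma norm_integral_exp_quadratic_le {t : ℝ} (ht : t ≠ 0) (a x : ℝ) :
    ‖∫ u in (0:ℝ)..x, Complex.exp (Complex.I * ((t * u ^ 2 + a * u : ℝ) : ℂ))‖
      ≤ 4 / √|t| := by
  rcases ht.lt_or_gt with h | h
  · have h1 := norm_integral_exp_quadratic_le_of_pos (neg_pos.mpr h) (-a) x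
    rw [abs_of_neg h]
    convert h1 using 1
    rw [← Complex.norm_conj, ← intervalIntegral.intervalIntegral_conj]
    congr 1
    refine intervalIntegral.integral_congr fun u _ => ?_
    simp only [← Complex.exp_conj, map_mul, Complex.conj_I, Complex.conj_ofReal]
    congr 1
    push_cast
    ring
  · rw [abs_of_pos h]
    exact norm_integral_exp_quadratic_le_of_pos h a x

/-- One-dimensional dispersive estimate, uniform in the frequency shift `a`. -/
lemma exists_norm_integral_exp_quadratic_mul_le {φ : ℝ → ℂ} (hφ : ContDiff ℝ 1 φ) (L : ℝ) :
    ∃ C : ℝ, 0 ≤ C ∧ ∀ t : ℝ, t ≠ 0 → ∀ a : ℝ,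
      ‖∫ u in (0:ℝ)..L, Complex.exp (Complex.I * ((t * u ^ 2 + a * u : ℝ) : ℂ)) * φ u‖
        ≤ C / √|t| := by
  have hφ' : Continuous (deriv φ) := hφ.continuous_deriv le_rfl
  obtain ⟨M, hM⟩ := (isCompact_uIcc (a := (0:ℝ)) (b := L)).exists_bound_of_continuousOn
    hφ'.continuousOn
  have hM0 : 0 ≤ M := (norm_nonneg _).trans (hM 0 Set.left_mem_uIcc)
  refine ⟨4 * (‖φ L‖ + M * |L|), by positivity, fun t ht a => ?_⟩
  set e : ℝ → ℂ := fun u => Complex.exp (Complex.I * ((t * u ^ 2 + a * u : ℝ) : ℂ))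
  have hec : Continuous e := by fun_prop
  set F : ℝ → ℂ := fun x => ∫ u in (0:ℝ)..x, e u
  have hFd : ∀ x, HasDerivAt F (e x) x := fun x =>
    intervalIntegral.integral_hasDerivAt_right (hec.intervalIntegrable _ _)
      (hec.stronglyMeasurableAtFilter _ _) hec.continuousAt
  have hFb : ∀ x, ‖F x‖ ≤ 4 / √|t| := norm_integral_exp_quadratic_le ht a
  have hparts := intervalIntegral.integral_deriv_mul_eq_sub (a := 0) (b := L)
    (u := F) (v := φ) (u' := e) (v' := deriv φ) (fun x _ => hFd x)
    (fun x _ => (hφ.differentiable one_ne_zero x).hasDerivAt)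
    (hec.intervalIntegrable _ _) (hφ'.intervalIntegrable _ _)
  have hFc : Continuous F := continuous_iff_continuousAt.mpr fun x => (hFd x).continuousAt
  have hadd := intervalIntegral.integral_add (μ := volume)
    ((hec.mul hφ.continuous).intervalIntegrable 0 L) ((hFc.mul hφ').intervalIntegrable 0 L)
  simp only [Pi.mul_apply] at hadd
  rw [hadd] at hparts
  have hF0 : F 0 = 0 := intervalIntegral.integral_same
  rw [hF0, zero_mul, sub_zero] at hparts
  rw [eq_sub_of_add_eq hparts]
  refine (norm_sub_le _ _).trans ?_
  have h1 : ‖F L * φ L‖ ≤ 4 / √|t| * ‖φ L‖ := by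
    rw [norm_mul]
    gcongr
    exact hFb L
  have h2 : ‖∫ x in (0:ℝ)..L, F x * deriv φ x‖ ≤ 4 / √|t| * M * |L - 0| := by
    refine intervalIntegral.norm_integral_le_of_norm_le_const fun x hx => ?_
    rw [norm_mul]
    gcongr
    · exact hFb x
    · exact hM x (Set.uIoc_subset_uIcc hx)
  rw [sub_zero] at h2
  calc _ ≤ 4 / √|t| * ‖φ L‖ + 4 / √|t| * M * |L| := add_le_add h1 h2
    _ = _ := by ring

/-- The Poisson-type integral `λ^{2k+1} ∫_{-1}^{1} (1 - s²)^k e^{iλrs} ds`, a multiple of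
`(λ/r)^{k+1/2} J_{k+1/2}(λr)`. -/
noncomputable def poissonInt (k : ℕ) (r lam : ℝ) : ℂ :=
  (lam : ℂ) ^ (2 * k + 1) *
    ∫ s in (-1:ℝ)..1, (1 - (s : ℂ) ^ 2) ^ k * Complex.exp (Complex.I * lam * r * s)

lemma poissonInt_zero (k : ℕ) (r : ℝ) : poissonInt k r 0 = 0 := by
  simp [poissonInt]

lemma hasDerivAt_integral_one_sub_sq_pow_mul_exp (k : ℕ) (r lam : ℝ) :
    HasDerivAt (fun lam : ℝ => ∫ s in (-1:ℝ)..1,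
        (1 - (s : ℂ) ^ 2) ^ k * Complex.exp (Complex.I * lam * r * s))
      (∫ s in (-1:ℝ)..1, (1 - (s : ℂ) ^ 2) ^ k *
        (Complex.exp (Complex.I * lam * r * s) * (Complex.I * r * s))) lam := by
  refine (intervalIntegral.hasDerivAt_integral_of_dominated_loc_of_deriv_le
    (s := Set.univ) (bound := fun s => ‖(1 - (s : ℂ) ^ 2) ^ k‖ * ‖Complex.I * r * s‖)
    (F := fun (lam : ℝ) (s : ℝ) =>
      (1 - (s : ℂ) ^ 2) ^ k * Complex.exp (Complex.I * lam * r * s))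
    (F' := fun (lam : ℝ) (s : ℝ) =>
      (1 - (s : ℂ) ^ 2) ^ k * (Complex.exp (Complex.I * lam * r * s) * (Complex.I * r * s)))
    Filter.univ_mem ?_ ?_ ?_ ?_ ?_ ?_).2
  · exact Filter.Eventually.of_forall fun x =>
      Continuous.aestronglyMeasurable (by fun_prop)
  · exact Continuous.intervalIntegrable (by fun_prop) _ _
  · exact Continuous.aestronglyMeasurable (by fun_prop)
  · refine Filter.Eventually.of_forall fun s _ x _ => ?_
    have : ‖Complex.exp (Complex.I * x * r * s)‖ = 1 := by
      rw [show Complex.I * x * r * s = ((x * r * s : ℝ) : ℂ) * Complex.I by push_cast; ring,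
        Complex.norm_exp_ofReal_mul_I]
    rw [norm_mul, norm_mul, this, one_mul]
  · exact Continuous.intervalIntegrable (by fun_prop) _ _
  · refine Filter.Eventually.of_forall fun s _ x _ => ?_
    have hid : HasDerivAt (fun u : ℝ => (u : ℂ)) 1 x := Complex.ofRealCLM.hasDerivAt
    refine (((((hid.const_mul Complex.I).mul_const (r : ℂ)).mul_const
      (s : ℂ)).cexp).const_mul _).congr_deriv ?_
    ring

lemma hasDerivAt_mul_cexp_mul_ofReal (c : ℂ) (s : ℝ) :
    HasDerivAt (fun s : ℝ => (s : ℂ) * Complex.exp (c * s))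
      (Complex.exp (c * s) + s * (Complex.exp (c * s) * c)) s := by
  have hid : HasDerivAt (fun u : ℝ => (u : ℂ)) 1 s := Complex.ofRealCLM.hasDerivAt
  refine (hid.mul ((hid.const_mul c).cexp)).congr_deriv ?_
  ring

lemma hasDerivAt_poissonInt_zero (r lam : ℝ) :
    HasDerivAt (poissonInt 0 r)
      (Complex.exp (Complex.I * lam * r) + Complex.exp (-(Complex.I * lam * r))) lam := by
  have hid : HasDerivAt (fun u : ℝ => (u : ℂ)) 1 lam := Complex.ofRealCLM.hasDerivAt
  refine ((hid.pow (2 * 0 + 1)).mul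
    (hasDerivAt_integral_one_sub_sq_pow_mul_exp 0 r lam)).congr_deriv ?_
  have hF := intervalIntegral.integral_eq_sub_of_hasDerivAt (a := -1) (b := 1)
    (fun s _ => hasDerivAt_mul_cexp_mul_ofReal (Complex.I * lam * r) s)
    (Continuous.intervalIntegrable (by fun_prop) _ _)
  rw [intervalIntegral.integral_add (Continuous.intervalIntegrable (by fun_prop) _ _)
    (Continuous.intervalIntegrable (by fun_prop) _ _)] at hF
  simp only [Pi.pow_apply, pow_zero, one_mul, mul_zero, zero_add, Nat.cast_one, tsub_self,
    pow_one, mul_one]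
  rw [← intervalIntegral.integral_const_mul]
  convert hF using 1
  · congr 1
    refine intervalIntegral.integral_congr fun s _ => ?_
    ring
  · push_cast
    simp

lemma hasDerivAt_poissonInt_succ (k : ℕ) (r lam : ℝ) :
    HasDerivAt (poissonInt (k + 1) r) (2 * (k + 1) * (lam * poissonInt k r lam)) lam := by
  have hid : HasDerivAt (fun u : ℝ => (u : ℂ)) 1 lam := Complex.ofRealCLM.hasDerivAt
  refine ((hid.pow (2 * (k + 1) + 1)).mul
    (hasDerivAt_integral_one_sub_sq_pow_mul_exp (k + 1) r lam)).congr_deriv ?_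
  have hd : ∀ s : ℝ, HasDerivAt (fun s : ℝ => (1 - (s : ℂ) ^ 2) ^ (k + 1) *
      ((s : ℂ) * Complex.exp (Complex.I * lam * r * s)))
      ((2 * (k + 1) + 1) *
          ((1 - (s : ℂ) ^ 2) ^ (k + 1) * Complex.exp (Complex.I * lam * r * s))
        - 2 * (k + 1) * ((1 - (s : ℂ) ^ 2) ^ k * Complex.exp (Complex.I * lam * r * s))
        + lam * ((1 - (s : ℂ) ^ 2) ^ (k + 1) *
          (Complex.exp (Complex.I * lam * r * s) * (Complex.I * r * s)))) s := by
    intro s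
    have hs : HasDerivAt (fun u : ℝ => (u : ℂ)) 1 s := Complex.ofRealCLM.hasDerivAt
    refine ((((hs.pow 2).const_sub 1).pow (k + 1)).mul
      (hasDerivAt_mul_cexp_mul_ofReal (Complex.I * lam * r) s)).congr_deriv ?_
    simp only [Pi.pow_apply, Nat.add_sub_cancel, pow_succ]
    push_cast
    ring
  have hF := intervalIntegral.integral_eq_sub_of_hasDerivAt (a := -1) (b := 1)
    (fun s _ => hd s) (Continuous.intervalIntegrable (by fun_prop) _ _)
  rw [intervalIntegral.integral_add (Continuous.intervalIntegrable (by fun_prop) _ _)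
    (Continuous.intervalIntegrable (by fun_prop) _ _),
    intervalIntegral.integral_sub (Continuous.intervalIntegrable (by fun_prop) _ _)
    (Continuous.intervalIntegrable (by fun_prop) _ _),
    intervalIntegral.integral_const_mul, intervalIntegral.integral_const_mul,
    intervalIntegral.integral_const_mul] at hF
  simp only [Complex.ofReal_neg, Complex.ofReal_one, neg_sq, one_pow, sub_self, ne_eq,
    Nat.add_eq_zero_iff, one_ne_zero, and_false, not_false_eq_true, zero_pow, zero_mul] at hF
  simp only [Pi.pow_apply, poissonInt, Nat.add_sub_cancel]
  push_cast
  simp only [mul_add, mul_one, pow_add, pow_succ _ 0] at hF ⊢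
  linear_combination (lam : ℂ) ^ (2 * k) * lam ^ 2 * hF

lemma continuous_poissonInt (k : ℕ) (r : ℝ) : Continuous (poissonInt k r) := by
  refine continuous_iff_continuousAt.mpr fun x => ?_
  rcases k with - | k
  · exact (hasDerivAt_poissonInt_zero r x).continuousAt
  · exact (hasDerivAt_poissonInt_succ k r x).continuousAt

/-- The finite sum occurring in `gker (2k+3)`, in terms of `w = -2iλr`. -/
noncomputable def hankelSum (k : ℕ) (w : ℂ) : ℂ :=
  ∑ l ∈ Finset.range (k + 1),
    ((Nat.factorial (2 * k - l) : ℂ) /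
      ((Nat.factorial l : ℂ) * (Nat.factorial (k - l) : ℂ))) * w ^ l

/-- The sum obtained from `hankelSum` by termwise differentiation. -/
noncomputable def hankelSumDeriv (k : ℕ) (w : ℂ) : ℂ :=
  ∑ l ∈ Finset.range (k + 1),
    ((Nat.factorial (2 * k - l) : ℂ) /
      ((Nat.factorial l : ℂ) * (Nat.factorial (k - l) : ℂ))) * (l * w ^ (l - 1))

lemma hasDerivAt_hankelSum (k : ℕ) (w : ℂ) :
    HasDerivAt (hankelSum k) (hankelSumDeriv k w) w :=
  HasDerivAt.fun_sum fun l _ => (hasDerivAt_pow l w).const_mul _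

lemma hankelSum_succ_sub (k : ℕ) (w : ℂ) :
    hankelSum (k + 1) w - 2 * hankelSumDeriv (k + 1) w = w * hankelSum k w := by
  simp only [hankelSum, hankelSumDeriv]
  rw [Finset.sum_range_succ, Finset.sum_range_succ' _ (k + 1)]
  simp only [Nat.cast_zero, zero_mul, mul_zero, add_zero, Nat.add_sub_cancel]
  rw [add_sub_right_comm, Finset.mul_sum, ← Finset.sum_sub_distrib,
    Finset.sum_range_succ' _ k, Finset.mul_sum, Finset.sum_range_succ _ k]
  have h0 : ∀ a : ℕ, (Nat.factorial a : ℂ) ≠ 0 := fun a => by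
    exact_mod_cast Nat.factorial_ne_zero a
  have e1 : ∀ l ∈ Finset.range k,
      ((Nat.factorial (2 * (k + 1) - (l + 1)) : ℂ) /
        ((Nat.factorial (l + 1) : ℂ) * (Nat.factorial (k + 1 - (l + 1)) : ℂ))) * w ^ (l + 1)
      - 2 * (((Nat.factorial (2 * (k + 1) - (l + 1 + 1)) : ℂ) /
        ((Nat.factorial (l + 1 + 1) : ℂ) * (Nat.factorial (k + 1 - (l + 1 + 1)) : ℂ))) *
          (((l + 1 + 1 : ℕ) : ℂ) * w ^ (l + 1)))
      = w * (((Nat.factorial (2 * k - l) : ℂ) /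
        ((Nat.factorial l : ℂ) * (Nat.factorial (k - l) : ℂ))) * w ^ l) := by
    intro l hl
    obtain ⟨d, rfl⟩ := Nat.exists_eq_add_of_lt (Finset.mem_range.mp hl)
    rw [show 2 * (l + d + 1 + 1) - (l + 1) = (l + 2 * d + 1) + 1 + 1 by omega,
      show l + d + 1 + 1 - (l + 1) = d + 1 by omega,
      show 2 * (l + d + 1 + 1) - (l + 1 + 1) = l + 2 * d + 1 + 1 by omega,
      show l + d + 1 + 1 - (l + 1 + 1) = d by omega,
      show 2 * (l + d + 1) - l = l + 2 * d + 1 + 1 by omega,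
      show l + d + 1 - l = d + 1 by omega]
    rw [Nat.factorial_succ (l + 2 * d + 1 + 1), Nat.factorial_succ (l + 1), Nat.factorial_succ d,
      Nat.factorial_succ l]
    have hh1 := h0 l
    have hh2 := h0 d
    have hl1 : (l : ℂ) + 1 ≠ 0 := by exact_mod_cast Nat.succ_ne_zero l
    have hl2 : (l : ℂ) + 1 + 1 ≠ 0 := by exact_mod_cast Nat.succ_ne_zero (l + 1)
    have hd1 : (d : ℂ) + 1 ≠ 0 := by exact_mod_cast Nat.succ_ne_zero d
    push_cast
    field_simp
    ring
  rw [Finset.sum_congr rfl e1]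
  have e2 : ((Nat.factorial (2 * (k + 1) - 0) : ℂ) /
        ((Nat.factorial 0 : ℂ) * (Nat.factorial (k + 1 - 0) : ℂ))) * w ^ 0
      - 2 * (((Nat.factorial (2 * (k + 1) - (0 + 1)) : ℂ) /
        ((Nat.factorial (0 + 1) : ℂ) * (Nat.factorial (k + 1 - (0 + 1)) : ℂ))) *
          (((0 + 1 : ℕ) : ℂ) * w ^ 0)) = 0 := by
    rw [show 2 * (k + 1) - 0 = 2 * k + 1 + 1 by omega,
      show 2 * (k + 1) - (0 + 1) = 2 * k + 1 by omega, Nat.sub_zero, Nat.add_sub_cancel,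
      Nat.factorial_succ (2 * k + 1), Nat.factorial_succ k]
    have hh1 := h0 k
    have hk1 : (k : ℂ) + 1 ≠ 0 := by exact_mod_cast Nat.succ_ne_zero k
    push_cast
    simp only [Nat.factorial_zero, Nat.factorial_succ 0]
    push_cast
    field_simp
    ring
  rw [e2, add_zero]
  congr 1
  rw [show 2 * (k + 1) - (k + 1) = k + 1 by omega, show 2 * k - k = k by omega, Nat.sub_self,
    Nat.sub_self, div_mul_cancel_left₀ (h0 _), div_mul_cancel_left₀ (h0 _), pow_succ]
  ring

/-- `gker (2k+3)` without its constant. -/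
noncomputable def hankelKer (k : ℕ) (r lam : ℝ) : ℂ :=
  Complex.exp (Complex.I * lam * r) / (r : ℂ) ^ (2 * k + 1) *
    hankelSum k ((-2) * Complex.I * r * lam)

lemma gker_eq (k : ℕ) (lam r : ℝ) :
    gker (2 * k + 3) lam r = resC (2 * k + 3) * hankelKer k r lam := by
  rw [gker, hankelKer, hankelSum, show (2 * k + 3 - 3) / 2 = k by omega,
    show 2 * k + 3 - 2 = 2 * k + 1 by omega, show 2 * k + 3 - 3 = 2 * k by omega]
  ring

lemma hasDerivAt_hankelKer_succ (k : ℕ) {r : ℝ} (hr : r ≠ 0) (lam : ℝ) :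
    HasDerivAt (hankelKer (k + 1) r) (2 * lam * hankelKer k r lam) lam := by
  have hid : HasDerivAt (fun u : ℝ => (u : ℂ)) 1 lam := Complex.ofRealCLM.hasDerivAt
  have h1 := ((hid.const_mul Complex.I).mul_const (r : ℂ)).cexp.div_const
    ((r : ℂ) ^ (2 * (k + 1) + 1))
  have h2 := (hasDerivAt_hankelSum (k + 1) ((-2) * Complex.I * r * lam)).comp lam
    (hid.const_mul ((-2) * Complex.I * r))
  refine (h1.mul h2).congr_deriv ?_
  have hs := hankelSum_succ_sub k ((-2) * Complex.I * r * lam)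
  have hr' : (r : ℂ) ≠ 0 := by exact_mod_cast hr
  simp only [Function.comp_apply, hankelKer]
  rw [sub_eq_iff_eq_add.mp hs]
  rw [show 2 * (k + 1) + 1 = 2 * k + 1 + 2 by ring, pow_add (r : ℂ) (2 * k + 1) 2]
  field_simp
  ring_nf
  simp only [Complex.I_sq]
  ring

lemma hasDerivAt_hankelKer_succ_sub (k : ℕ) {r : ℝ} (hr : r ≠ 0) (lam : ℝ) :
    HasDerivAt (fun lam => hankelKer (k + 1) r lam - hankelKer (k + 1) r (-lam))
      (2 * (lam * (hankelKer k r lam - hankelKer k r (-lam)))) lam := by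
  have h2 := (hasDerivAt_hankelKer_succ k hr (-lam)).scomp lam (hasDerivAt_neg lam)
  refine ((hasDerivAt_hankelKer_succ k hr lam).sub h2).congr_deriv ?_
  simp only [Complex.real_smul]
  push_cast
  ring

lemma hankelKer_sub_eq_poissonInt (k : ℕ) {r : ℝ} (hr : r ≠ 0) (lam : ℝ) :
    hankelKer k r lam - hankelKer k r (-lam)
      = Complex.I / (Nat.factorial k : ℂ) * poissonInt k r lam := by
  suffices h : ∀ f f' : ℝ → ℂ, (∀ x, HasDerivAt f (f' x) x) → (∀ x, f' x = 0) → f 0 = 0 →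
      ∀ x, f x = 0 by
    have hr' : (r : ℂ) ≠ 0 := by exact_mod_cast hr
    rw [← sub_eq_zero]
    induction k generalizing lam with
    | zero =>
      refine h (fun lam => hankelKer 0 r lam - hankelKer 0 r (-lam)
        - Complex.I / (Nat.factorial 0 : ℂ) * poissonInt 0 r lam) (fun _ => 0)
        (fun x => ?_) (fun x => rfl) ?_ lam
      · have hid : HasDerivAt (fun u : ℝ => (u : ℂ)) 1 x := Complex.ofRealCLM.hasDerivAt
        have e1 : (fun lam => hankelKer 0 r lam - hankelKer 0 r (-lam)
          - Complex.I / (Nat.factorial 0 : ℂ) * poissonInt 0 r lam) =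
          fun lam : ℝ => Complex.exp (Complex.I * lam * r) / r
            - Complex.exp (-(Complex.I * lam) * r) / r - Complex.I * poissonInt 0 r lam := by
          funext lam
          simp [hankelKer, hankelSum]
        rw [e1]
        refine (((((hid.const_mul Complex.I).mul_const (r : ℂ)).cexp.div_const (r : ℂ)).sub
          (((hid.const_mul Complex.I).neg.mul_const (r : ℂ)).cexp.div_const (r : ℂ))).sub
          ((hasDerivAt_poissonInt_zero r x).const_mul Complex.I)).congr_deriv ?_
        simp only [Pi.neg_apply]
        field_simp
        ring
      · simp [poissonInt_zero]
    | succ k ih =>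
      refine h (fun lam => hankelKer (k + 1) r lam - hankelKer (k + 1) r (-lam)
        - Complex.I / (Nat.factorial (k + 1) : ℂ) * poissonInt (k + 1) r lam) _
        (fun x => (hasDerivAt_hankelKer_succ_sub k hr x).sub
          ((hasDerivAt_poissonInt_succ k r x).const_mul _)) (fun x => ?_) ?_ lam
      · have hk1 : (k : ℂ) + 1 ≠ 0 := by exact_mod_cast Nat.succ_ne_zero k
        have hk : (Nat.factorial k : ℂ) ≠ 0 := by exact_mod_cast Nat.factorial_ne_zero k
        rw [sub_eq_zero.mp (ih x), Nat.factorial_succ]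
        push_cast
        field_simp
        ring
      · simp [poissonInt_zero]
  intro f f' hf hf' h0 x
  rw [← h0]
  exact is_const_of_deriv_eq_zero (fun x => (hf x).differentiableAt)
    (fun x => by rw [(hf x).deriv, hf']) x 0

lemma exists_norm_integral_mul_poissonInt_le {φ : ℝ → ℂ} (hφ : ContDiff ℝ 1 φ) (L : ℝ)
    (k : ℕ) :
    ∃ C : ℝ, 0 ≤ C ∧ ∀ t : ℝ, t ≠ 0 → ∀ r : ℝ,
      ‖∫ u in (0:ℝ)..L, Complex.exp (Complex.I * t * (u : ℂ) ^ 2) *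
        (φ u * poissonInt k r u)‖ ≤ C / √|t| := by
  have hid : ContDiff ℝ 1 (fun u : ℝ => (u : ℂ)) := Complex.ofRealCLM.contDiff
  obtain ⟨C, hC, h⟩ := exists_norm_integral_exp_quadratic_mul_le
    (hφ.mul (hid.pow (2 * k + 1))) L
  refine ⟨2 * C, by positivity, fun t ht r => ?_⟩
  have hφc := hφ.continuous
  set F : ℝ → ℝ → ℂ := fun u s => (1 - (s : ℂ) ^ 2) ^ k *
    (Complex.exp (Complex.I * ((t * u ^ 2 + r * s * u : ℝ) : ℂ)) *
      (φ u * (u : ℂ) ^ (2 * k + 1))) with hF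
  have e1 : ∫ u in (0:ℝ)..L, Complex.exp (Complex.I * t * (u : ℂ) ^ 2) *
      (φ u * poissonInt k r u) = ∫ u in (0:ℝ)..L, ∫ s in (-1:ℝ)..1, F u s := by
    refine intervalIntegral.integral_congr fun u _ => ?_
    simp only [poissonInt]
    rw [← mul_assoc, ← mul_assoc, ← intervalIntegral.integral_const_mul]
    refine intervalIntegral.integral_congr fun s _ => ?_
    simp only [hF]
    rw [show Complex.I * ((t * u ^ 2 + r * s * u : ℝ) : ℂ)
      = Complex.I * t * (u : ℂ) ^ 2 + Complex.I * u * r * s by push_cast; ring, Complex.exp_add]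
    ring
  have hFc : Continuous F.uncurry := by
    simp only [hF, Function.uncurry_def]
    fun_prop
  rw [e1, MeasureTheory.intervalIntegral_intervalIntegral_swap]
  · have := intervalIntegral.norm_integral_le_of_norm_le_const (a := -1) (b := 1)
      (f := fun s => ∫ u in (0:ℝ)..L, F u s) (C := C / √|t|) (fun s hs => ?_)
    · refine this.trans (le_of_eq ?_)
      norm_num
      ring
    · rw [Set.uIoc_of_le (by norm_num)] at hs
      simp only [hF]
      rw [intervalIntegral.integral_const_mul, norm_mul]
      have h1 : ‖(1 - (s : ℂ) ^ 2) ^ k‖ ≤ 1 := by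
        rw [norm_pow, ← Complex.ofReal_pow, ← Complex.ofReal_one, ← Complex.ofReal_sub,
          Complex.norm_real, Real.norm_eq_abs]
        refine pow_le_one₀ (abs_nonneg _) (abs_le.mpr ⟨?_, ?_⟩) <;> nlinarith [hs.1, hs.2]
      calc _ ≤ 1 * (C / √|t|) := mul_le_mul h1 (h t ht (r * s)) (norm_nonneg _) zero_le_one
        _ = _ := one_mul _
  · exact (hFc.continuousOn.integrableOn_compact
      (isCompact_uIcc.prod isCompact_uIcc)).mono_set
      (Set.prod_mono Set.uIoc_subset_uIcc Set.uIoc_subset_uIcc)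

lemma contDiff_deriv_div {ψ : ℝ → ℂ} (hψ : ContDiff ℝ (⊤ : ℕ∞) ψ) {δ : ℝ} (hδ : 0 < δ)
    {c : ℂ} (hc : ∀ x ≤ δ, ψ x = c) :
    ContDiff ℝ (⊤ : ℕ∞) (fun x : ℝ => deriv ψ x / (x : ℂ)) := by
  have hd : ContDiff ℝ (⊤ : ℕ∞) (deriv ψ) := (contDiff_infty_iff_deriv.mp hψ).2
  refine contDiff_iff_contDiffAt.mpr fun x => ?_
  rcases eq_or_ne x 0 with rfl | hx
  · refine contDiffAt_const (c := (0 : ℂ)) |>.congr_of_eventuallyEq ?_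
    filter_upwards [Iio_mem_nhds hδ] with y hy
    have : ψ =ᶠ[nhds y] fun _ => c := by
      filter_upwards [Iio_mem_nhds hy] with z hz using hc z (le_of_lt hz)
    rw [this.deriv_eq, deriv_const, zero_div]
  · have hx' : Complex.ofRealCLM x ≠ 0 := by simpa using hx
    simp only [div_eq_mul_inv]
    exact hd.contDiffAt.mul (Complex.ofRealCLM.contDiff.contDiffAt.inv hx')

lemma deriv_eq_zero_of_eq_const_of_le {ψ : ℝ → ℂ} (hψ : ContDiff ℝ (⊤ : ℕ∞) ψ) {δ : ℝ}
    {c : ℂ} (hc : ∀ x ≤ δ, ψ x = c) {x : ℝ} (hx : x ≤ δ) : deriv ψ x = 0 := by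
  have hd := ((hψ.differentiable (by simp)) x).hasDerivAt.hasDerivWithinAt (s := Set.Iic x)
  have h2 : HasDerivWithinAt ψ 0 (Set.Iic x) x :=
    (hasDerivWithinAt_const x _ c).congr (fun y hy => hc y (le_trans hy hx)) (hc x hx)
  exact (uniqueDiffOn_Iic x x Set.self_mem_Iic).eq_deriv _ hd h2

lemma deriv_eq_zero_of_eq_zero_of_ge {ψ : ℝ → ℂ} (hψ : ContDiff ℝ (⊤ : ℕ∞) ψ) {L : ℝ}
    (hc : ∀ x, L ≤ x → ψ x = 0) {x : ℝ} (hx : L ≤ x) : deriv ψ x = 0 := by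
  have hd := ((hψ.differentiable (by simp)) x).hasDerivAt.hasDerivWithinAt (s := Set.Ici x)
  have h2 : HasDerivWithinAt ψ 0 (Set.Ici x) x :=
    (hasDerivWithinAt_const x _ 0).congr (fun y hy => hc y (le_trans hx hy)) (hc x hx)
  exact (uniqueDiffOn_Ici x x Set.self_mem_Ici).eq_deriv _ hd h2

/-- Integration by parts against `λ e^{itλ²}`. -/
lemma integral_exp_mul_poissonInt_by_parts {ψ : ℝ → ℂ} (hψ : ContDiff ℝ (⊤ : ℕ∞) ψ) {L δ : ℝ}
    {c : ℂ} (hδ : 0 < δ) (hc : ∀ x ≤ δ, ψ x = c) (hL : ψ L = 0) (k : ℕ) {r : ℝ} {A' : ℝ → ℂ}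
    (hA : ∀ x, HasDerivAt (poissonInt k r) (A' x) x) (hA' : Continuous A')
    {t : ℝ} (ht : t ≠ 0) :
    ∫ u in (0:ℝ)..L, Complex.exp (Complex.I * t * (u : ℂ) ^ 2) * (u * ψ u * poissonInt k r u)
      = -(2 * Complex.I * t)⁻¹ *
        ((∫ u in (0:ℝ)..L, Complex.exp (Complex.I * t * (u : ℂ) ^ 2) *
          (u * (deriv ψ u / u) * poissonInt k r u))
        + ∫ u in (0:ℝ)..L, Complex.exp (Complex.I * t * (u : ℂ) ^ 2) * (ψ u * A' u)) := by
  have ht' : (t : ℂ) ≠ 0 := by exact_mod_cast ht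
  have hd : Continuous (deriv ψ) := hψ.continuous_deriv (by simp)
  have hψc : Continuous ψ := hψ.continuous
  have hAc := continuous_poissonInt k r
  have hu : ∀ x : ℝ, HasDerivAt
      (fun x : ℝ => (2 * Complex.I * t)⁻¹ * Complex.exp (Complex.I * t * (x : ℂ) ^ 2))
      (x * Complex.exp (Complex.I * t * (x : ℂ) ^ 2)) x := by
    intro x
    have hid : HasDerivAt (fun u : ℝ => (u : ℂ)) 1 x := Complex.ofRealCLM.hasDerivAt
    refine ((((hid.pow 2).const_mul (Complex.I * t)).cexp).const_mul _).congr_deriv ?_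
    simp only [Pi.pow_apply]
    have hI : Complex.I ≠ 0 := Complex.I_ne_zero
    field_simp
    push_cast
    ring
  have hv : ∀ x : ℝ, HasDerivAt (fun x => ψ x * poissonInt k r x)
      (deriv ψ x * poissonInt k r x + ψ x * A' x) x := fun x =>
    ((hψ.differentiable (by simp)) x).hasDerivAt.mul (hA x)
  have h := intervalIntegral.integral_mul_deriv_eq_deriv_mul (a := 0) (b := L)
    (fun x _ => hv x) (fun x _ => hu x)
    (Continuous.intervalIntegrable (by fun_prop) _ _)
    (Continuous.intervalIntegrable (by fun_prop) _ _)
  rw [hL, poissonInt_zero, mul_zero, zero_mul, zero_mul, zero_mul, sub_self, zero_sub] at h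
  have e1 : ∀ u : ℝ, (u : ℂ) * (deriv ψ u / u) = deriv ψ u := by
    intro u
    rcases eq_or_ne u 0 with rfl | hu0
    · rw [deriv_eq_zero_of_eq_const_of_le hψ hc hδ.le]
      simp
    · exact mul_div_cancel₀ _ (by exact_mod_cast hu0)
  simp_rw [e1]
  rw [← intervalIntegral.integral_add (Continuous.intervalIntegrable (by fun_prop) _ _)
    (Continuous.intervalIntegrable (by fun_prop) _ _), ← intervalIntegral.integral_const_mul]
  calc _ = ∫ x in (0:ℝ)..L, ψ x * poissonInt k r x *
        (x * Complex.exp (Complex.I * t * (x : ℂ) ^ 2)) :=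
        intervalIntegral.integral_congr fun x _ => by ring
    _ = _ := h
    _ = _ := by
      rw [← intervalIntegral.integral_neg]
      exact intervalIntegral.integral_congr fun x _ => by ring

lemma exists_norm_integral_exp_mul_deriv_poissonInt_zero_le {φ : ℝ → ℂ} (hφ : ContDiff ℝ 1 φ)
    (L : ℝ) :
    ∃ C : ℝ, 0 ≤ C ∧ ∀ t : ℝ, t ≠ 0 → ∀ r : ℝ,
      ‖∫ u in (0:ℝ)..L, Complex.exp (Complex.I * t * (u : ℂ) ^ 2) * (φ u *
        (Complex.exp (Complex.I * u * r) + Complex.exp (-(Complex.I * u * r))))‖ ≤ C / √|t| := by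
  obtain ⟨C, hC, h⟩ := exists_norm_integral_exp_quadratic_mul_le hφ L
  refine ⟨2 * C, by positivity, fun t ht r => ?_⟩
  have hφc := hφ.continuous
  have e : ∫ u in (0:ℝ)..L, Complex.exp (Complex.I * t * (u : ℂ) ^ 2) * (φ u *
        (Complex.exp (Complex.I * u * r) + Complex.exp (-(Complex.I * u * r))))
      = (∫ u in (0:ℝ)..L, Complex.exp (Complex.I * ((t * u ^ 2 + r * u : ℝ) : ℂ)) * φ u)
        + ∫ u in (0:ℝ)..L, Complex.exp (Complex.I * ((t * u ^ 2 + -r * u : ℝ) : ℂ)) * φ u := by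
    rw [← intervalIntegral.integral_add (Continuous.intervalIntegrable (by fun_prop) _ _)
      (Continuous.intervalIntegrable (by fun_prop) _ _)]
    refine intervalIntegral.integral_congr fun u _ => ?_
    rw [show Complex.I * ((t * u ^ 2 + r * u : ℝ) : ℂ)
        = Complex.I * t * (u : ℂ) ^ 2 + Complex.I * u * r by push_cast; ring,
      show Complex.I * ((t * u ^ 2 + -r * u : ℝ) : ℂ)
        = Complex.I * t * (u : ℂ) ^ 2 + -(Complex.I * u * r) by push_cast; ring,
      Complex.exp_add, Complex.exp_add]
    ring
  rw [e]
  calc _ ≤ C / √|t| + C / √|t| := (norm_add_le _ _).trans (add_le_add (h t ht r) (h t ht (-r)))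
    _ = _ := by ring

/-- The dispersive estimate for `poissonInt`: each integration by parts gains a factor `|t|⁻¹`,
and at most `k + 1` of them are possible. -/
lemma exists_norm_integral_mul_cutoff_mul_poissonInt_le (L : ℝ) (j : ℕ) :
    ∀ k : ℕ, j ≤ k + 1 → ∀ ψ : ℝ → ℂ, ContDiff ℝ (⊤ : ℕ∞) ψ →
      (∃ δ : ℝ, 0 < δ ∧ ∃ c : ℂ, ∀ x ≤ δ, ψ x = c) → (∀ x, L ≤ x → ψ x = 0) →
      ∃ C : ℝ, 0 ≤ C ∧ ∀ t : ℝ, t ≠ 0 → ∀ r : ℝ,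
        ‖∫ u in (0:ℝ)..L, Complex.exp (Complex.I * t * (u : ℂ) ^ 2) *
          (u * ψ u * poissonInt k r u)‖ ≤ C / √|t| / |t| ^ j := by
  induction j with
  | zero =>
    intro k _ ψ hψ _ _
    obtain ⟨C, hC, h⟩ := exists_norm_integral_mul_poissonInt_le
      (Complex.ofRealCLM.contDiff.mul (hψ.of_le (by simp))) L k
    exact ⟨C, hC, fun t ht r => by simpa using h t ht r⟩
  | succ j ih =>
    rintro k hk ψ hψ ⟨δ, hδ, c, hc⟩ hL
    have hflat : ∃ δ : ℝ, 0 < δ ∧ ∃ c : ℂ, ∀ x ≤ δ, deriv ψ x / (x : ℂ) = c :=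
      ⟨δ, hδ, 0, fun x hx => by
        rw [deriv_eq_zero_of_eq_const_of_le hψ hc hx, zero_div]⟩
    obtain ⟨C₁, hC₁, h₁⟩ := ih k (by omega) _ (contDiff_deriv_div hψ hδ hc) hflat
      (fun x hx => by rw [deriv_eq_zero_of_eq_zero_of_ge hψ hL hx, zero_div])
    obtain ⟨C₂, hC₂, A', hA, hA', h₂⟩ : ∃ C₂ : ℝ, 0 ≤ C₂ ∧ ∃ A' : ℝ → ℝ → ℂ,
        (∀ r x, HasDerivAt (poissonInt k r) (A' r x) x) ∧ (∀ r, Continuous (A' r)) ∧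
        ∀ t : ℝ, t ≠ 0 → ∀ r : ℝ, ‖∫ u in (0:ℝ)..L, Complex.exp (Complex.I * t * (u : ℂ) ^ 2) *
          (ψ u * A' r u)‖ ≤ C₂ / √|t| / |t| ^ j := by
      rcases k with - | k
      · obtain rfl : j = 0 := by omega
        obtain ⟨C, hC, h⟩ :=
          exists_norm_integral_exp_mul_deriv_poissonInt_zero_le (hψ.of_le (by simp)) L
        exact ⟨C, hC, _, hasDerivAt_poissonInt_zero, fun r => by fun_prop,
          fun t ht r => by simpa using h t ht r⟩
      · obtain ⟨C, hC, h⟩ := ih k (by omega) ψ hψ ⟨δ, hδ, c, hc⟩ hL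
        refine ⟨2 * (k + 1) * C, by positivity, _, hasDerivAt_poissonInt_succ k, fun r => ?_,
          fun t ht r => ?_⟩
        · have := continuous_poissonInt k r
          fun_prop
        · have e : ∫ u in (0:ℝ)..L, Complex.exp (Complex.I * t * (u : ℂ) ^ 2) *
              (ψ u * (2 * (k + 1) * (u * poissonInt k r u)))
              = (2 * (k + 1)) * ∫ u in (0:ℝ)..L, Complex.exp (Complex.I * t * (u : ℂ) ^ 2) *
                (u * ψ u * poissonInt k r u) := by
            rw [← intervalIntegral.integral_const_mul]
            exact intervalIntegral.integral_congr fun u _ => by ring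
          have hn : ‖(2 * (k + 1) : ℂ)‖ = 2 * (k + 1) := by
            exact_mod_cast Complex.norm_natCast (2 * (k + 1))
          rw [e, norm_mul, hn, mul_div_assoc, mul_div_assoc]
          exact mul_le_mul_of_nonneg_left (h t ht r) (by positivity)
    refine ⟨(C₁ + C₂) / 2, by positivity, fun t ht r => ?_⟩
    have ht0 : 0 < |t| := abs_pos.mpr ht
    rw [integral_exp_mul_poissonInt_by_parts hψ hδ hc (hL L le_rfl) k (hA r) (hA' r) ht, norm_mul,
      norm_neg, norm_inv, norm_mul, norm_mul, Complex.norm_I, Complex.norm_real,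
      Real.norm_eq_abs, Complex.norm_ofNat, mul_one]
    calc _ ≤ (2 * |t|)⁻¹ * (C₁ / √|t| / |t| ^ j + C₂ / √|t| / |t| ^ j) := by
          refine mul_le_mul_of_nonneg_left ?_ (by positivity)
          exact (norm_add_le _ _).trans (add_le_add (h₁ t ht r) (h₂ t ht r))
      _ = _ := by
          rw [pow_succ]
          field_simp

/-- Lemma 4.2 of the paper: the low-energy free evolution satisfies the dispersive bound
`sup_{x ≠ y} |∫₀^∞ e^{itλ²} λ χ(λ) [R₀⁺(λ²) − R₀⁻(λ²)](x,y) dλ| ≲ |t|^{−n/2}`,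
where `[R₀⁺(λ²) − R₀⁻(λ²)](x,y) = g_n(λ,|x−y|) − g_n(−λ,|x−y|)`. -/
theorem free_dispersive_bound (n : ℕ) (hn : 5 ≤ n) (hodd : Odd n)
    (lam1 : ℝ) (h0 : 0 < lam1) (h1 : lam1 ≤ 1)
    (χ : ℝ → ℝ) (hχ : ContDiff ℝ (⊤ : ℕ∞) χ)
    (hχ1 : ∀ lam : ℝ, lam ≤ lam1 / 2 → χ lam = 1)
    (hχ0 : ∀ lam : ℝ, lam1 ≤ lam → χ lam = 0) :
    ∃ C : ℝ, 0 < C ∧ ∀ t : ℝ, t ≠ 0 → ∀ x y : EuclideanSpace ℝ (Fin n), x ≠ y →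
      ‖∫ lam in Set.Ioi (0 : ℝ),
          Complex.exp (Complex.I * (t : ℂ) * (lam : ℂ) ^ 2) * (lam : ℂ) * (χ lam : ℂ) *
            (gker n lam ‖x - y‖ - gker n (-lam) ‖x - y‖)‖ ≤
        C * |t| ^ (-(n : ℝ) / 2) := by
  obtain ⟨k, rfl⟩ : ∃ k, n = 2 * k + 3 := by
    obtain ⟨m, rfl⟩ := hodd
    exact ⟨m - 1, by omega⟩
  obtain ⟨C, hC, h⟩ := exists_norm_integral_mul_cutoff_mul_poissonInt_le lam1 (k + 1) k le_rfl
    (fun x => (χ x : ℂ)) (Complex.ofRealCLM.contDiff.comp hχ)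
    ⟨lam1 / 2, half_pos h0, 1, fun x hx => by simp [hχ1 x hx]⟩
    (fun x hx => by simp [hχ0 x hx])
  set K : ℂ := resC (2 * k + 3) * (Complex.I / (Nat.factorial k : ℂ)) with hK
  refine ⟨‖K‖ * C + 1, by positivity, fun t ht x y hxy => ?_⟩
  have hr : ‖x - y‖ ≠ 0 := norm_ne_zero_iff.mpr (sub_ne_zero.mpr hxy)
  have ht0 : 0 < |t| := abs_pos.mpr ht
  have e : ∫ lam in Set.Ioi (0 : ℝ),
      Complex.exp (Complex.I * (t : ℂ) * (lam : ℂ) ^ 2) * (lam : ℂ) * (χ lam : ℂ) *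
        (gker (2 * k + 3) lam ‖x - y‖ - gker (2 * k + 3) (-lam) ‖x - y‖)
      = K * ∫ u in (0:ℝ)..lam1, Complex.exp (Complex.I * t * (u : ℂ) ^ 2) *
          (u * (χ u : ℂ) * poissonInt k ‖x - y‖ u) := by
    rw [← intervalIntegral.integral_const_mul, intervalIntegral.integral_of_le h0.le]
    have hkernel : ∀ lam : ℝ, Complex.exp (Complex.I * (t : ℂ) * (lam : ℂ) ^ 2) * (lam : ℂ) *
        (χ lam : ℂ) * (gker (2 * k + 3) lam ‖x - y‖ - gker (2 * k + 3) (-lam) ‖x - y‖)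
        = K * (Complex.exp (Complex.I * t * (lam : ℂ) ^ 2) *
          (lam * (χ lam : ℂ) * poissonInt k ‖x - y‖ lam)) := by
      intro lam
      rw [gker_eq, gker_eq, ← mul_sub, hankelKer_sub_eq_poissonInt k hr, hK]
      ring
    simp_rw [hkernel]
    refine (setIntegral_eq_of_subset_of_forall_sdiff_eq_zero measurableSet_Ioi
      (fun u hu => hu.1) fun u hu => ?_)
    have hu1 : lam1 ≤ u := le_of_lt (not_le.mp fun hle => hu.2 ⟨hu.1, hle⟩)
    simp [hχ0 u hu1]
  have hpow : |t| ^ (-((2 * k + 3 : ℕ) : ℝ) / 2) = 1 / √|t| / |t| ^ (k + 1) := by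
    rw [Real.sqrt_eq_rpow, ← Real.rpow_natCast, div_div, ← Real.rpow_add ht0, one_div,
      ← Real.rpow_neg ht0.le]
    congr 1
    push_cast
    ring
  rw [e, norm_mul, hpow]
  calc _ ≤ ‖K‖ * (C / √|t| / |t| ^ (k + 1)) :=
        mul_le_mul_of_nonneg_left (h t ht _) (norm_nonneg _)
    _ = ‖K‖ * C * (1 / √|t| / |t| ^ (k + 1)) := by ring
    _ ≤ _ := mul_le_mul_of_nonneg_right (by linarith) (by positivity)
end
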